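/- arXiv:1601.03248 — 2 statements merged into one kernel-verified Lean document; each statement's English description precedes it below -/
import Mathlib

section
/- Let G be a bridgeless cubic graph that has a 2-factor consisting of two circuits (i.e., there are two vertex-disjoint circuits C1 and C2 of G with V(G) = V(C1) ∪ V(C2)). Then G has a perfect matching cover of order 5; that is, there exist 5 perfect matchings of G such that every edge of G is contained in at least one of them. -/
/-- A multigraph on vertex type `V` with edge type `E`: each edge is assigned an
unordered pair of distinct endpoints (multiple edges allowed, loops forbidden). -/
structure Multigraph (V : Type*) (E : Type*) where
  inc : E → Sym2 V
  no_loops : ∀ e : E, ¬ (inc e).IsDiag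

namespace Multigraph

variable {V E : Type*} (G : Multigraph V E)

/-- The set of vertices incident with some edge in the edge set `F`. -/
def supp (F : Set E) : Set V := {v | ∃ e ∈ F, v ∈ G.inc e}

/-- The degree of a vertex `v` in the subgraph given by the edge set `F`. -/
noncomputable def deg (F : Set E) (v : V) : ℕ := {e ∈ F | v ∈ G.inc e}.ncard

/-- `G` is cubic, i.e. 3-regular. -/
def IsCubic : Prop := ∀ v : V, G.deg Set.univ v = 3

/-- Adjacency via an edge of the edge set `F`. -/
def Adj (F : Set E) (u v : V) : Prop := ∃ e ∈ F, G.inc e = s(u, v)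

/-- `u` and `v` are joined by a walk using only edges of `F`. -/
def Reach (F : Set E) : V → V → Prop := Relation.ReflTransGen (G.Adj F)

/-- `G` is bridgeless: no edge is a cut edge, i.e. the ends of every edge are
joined by a walk avoiding that edge. -/
def Bridgeless : Prop :=
  ∀ e : E, ∀ u v : V, G.inc e = s(u, v) → G.Reach (Set.univ \ {e}) u v

/-- `M` is a perfect matching of the subgraph of `G` with vertex set `S` whose
edges are the edges of `F` having both ends in `S`: the edges of `M` lie in `F`,
have both ends in `S`, and every vertex of `S` lies on exactly one edge of `M`. -/
def IsPMOn (S : Set V) (F : Set E) (M : Set E) : Prop :=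
  M ⊆ F ∧ (∀ e ∈ M, ∀ v ∈ G.inc e, v ∈ S) ∧ ∀ v ∈ S, ∃! e, e ∈ M ∧ v ∈ G.inc e

/-- `M` is a perfect matching of `G`. -/
def IsPM (M : Set E) : Prop := G.IsPMOn Set.univ Set.univ M

/-- The edge set `C` is a circuit of `G`: nonempty, 2-regular, and connected. -/
def IsCircuit (C : Set E) : Prop :=
  C.Nonempty ∧ (∀ v ∈ G.supp C, G.deg C v = 2) ∧
    ∀ u ∈ G.supp C, ∀ v ∈ G.supp C, G.Reach C u v

end Multigraph

theorem ZMod.val_sub_add {n : ℕ} [NeZero n] (z u : ZMod n) (k : ℕ)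
    (hk : (z - u).val + k < n) : (z + k - u).val = (z - u).val + k := by
  rw [show z + k - u = (z - u) + (k : ℕ) by ring, ZMod.val_add, ZMod.val_natCast]
  simp [Nat.mod_eq_of_lt hk]

theorem ZMod.eq_add_val_sub {n : ℕ} [NeZero n] (z u : ZMod n) : z = u + ((z - u).val : ℕ) := by
  simp

theorem ZMod.val_add_val_sub_comm {n : ℕ} [NeZero n] {z u : ZMod n} (hne : z ≠ u) :
    (z - u).val + (u - z).val = n := by
  have h0 : NeZero (z - u) := ⟨sub_ne_zero.2 hne⟩
  have h1 := ZMod.val_neg_of_ne_zero (z - u)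
  rw [neg_sub] at h1
  have := ZMod.val_lt (z - u)
  omega

section Dihedral

variable {X : Type*}

/-- The orbit of `p` under the cyclic group generated by `z ↦ b (a z)`. -/
def dihedralOrbit (a b : Equiv.Perm X) (p : X) : Set X := {z | ∃ i : ℤ, ((b * a) ^ i) p = z}

variable {a b : Equiv.Perm X} {p : X}

theorem mem_dihedralOrbit_self : p ∈ dihedralOrbit a b p := ⟨0, by simp⟩

theorem dihedral_b_zpow (ha : ∀ z, a (a z) = z) (hb : ∀ z, b (b z) = z) (hp : b p = p) (i : ℤ) :
    b (((b * a) ^ i) p) = ((b * a) ^ (-i)) p := by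
  have haa : a * a = 1 := by ext z; simp [ha]
  have hbb : b * b = 1 := by ext z; simp [hb]
  have hb1 : b⁻¹ = b := inv_eq_of_mul_eq_one_left hbb
  have ha1 : a⁻¹ = a := inv_eq_of_mul_eq_one_left haa
  have h1 : b * (b * a) ^ i * b⁻¹ = (b * a) ^ (-i) := by
    rw [← conj_zpow, zpow_neg, ← inv_zpow]
    congr 1
    rw [mul_inv_rev, hb1, ha1, ← mul_assoc, hbb, one_mul]
  have h2 := congrArg (fun f : Equiv.Perm X => f p) h1
  rw [hb1] at h2
  simpa [Equiv.Perm.mul_apply, hp] using h2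

theorem dihedral_a_zpow (ha : ∀ z, a (a z) = z) (hb : ∀ z, b (b z) = z) (hp : b p = p) (i : ℤ) :
    a (((b * a) ^ i) p) = ((b * a) ^ (-(i + 1))) p := by
  rw [← dihedral_b_zpow ha hb hp, add_comm, zpow_add, zpow_one]
  simp [Equiv.Perm.mul_apply, hb]

theorem b_mem_dihedralOrbit (ha : ∀ z, a (a z) = z) (hb : ∀ z, b (b z) = z) (hp : b p = p)
    {z : X} (hz : z ∈ dihedralOrbit a b p) : b z ∈ dihedralOrbit a b p := by
  obtain ⟨i, rfl⟩ := hz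
  exact ⟨_, (dihedral_b_zpow ha hb hp i).symm⟩

theorem a_mem_dihedralOrbit (ha : ∀ z, a (a z) = z) (hb : ∀ z, b (b z) = z) (hp : b p = p)
    {z : X} (hz : z ∈ dihedralOrbit a b p) : a z ∈ dihedralOrbit a b p := by
  obtain ⟨i, rfl⟩ := hz
  exact ⟨_, (dihedral_a_zpow ha hb hp i).symm⟩

theorem dihedralOrbit_subset (ha : ∀ z, a (a z) = z) (hb : ∀ z, b (b z) = z) {S : Set X}
    (hS : p ∈ S) (hSa : ∀ z ∈ S, a z ∈ S) (hSb : ∀ z ∈ S, b z ∈ S) :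
    dihedralOrbit a b p ⊆ S := by
  rintro _ ⟨i, rfl⟩
  have haa : a * a = 1 := by ext z; simp [ha]
  have hbb : b * b = 1 := by ext z; simp [hb]
  induction i with
  | zero => simpa
  | succ i ih =>
    rw [add_comm, zpow_add, zpow_one]
    exact hSb _ (hSa _ ih)
  | pred i ih =>
    rw [sub_eq_neg_add, zpow_add, zpow_neg_one, mul_inv_rev,
      inv_eq_of_mul_eq_one_left haa, inv_eq_of_mul_eq_one_left hbb]
    exact hSa _ (hSb _ ih)

theorem dihedralOrbit_unique (ha : ∀ z, a (a z) = z) (hb : ∀ z, b (b z) = z) (hp : b p = p)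
    {z w : X} (hz : z ∈ dihedralOrbit a b p) (hw : w ∈ dihedralOrbit a b p)
    (hza : a z = z) (hwa : a w = w) : z = w := by
  obtain ⟨i, rfl⟩ := hz
  obtain ⟨j, rfl⟩ := hw
  have key : ∀ k : ℤ, a (((b * a) ^ k) p) = ((b * a) ^ k) p → ((b * a) ^ (2 * k + 1)) p = p := by
    intro k hk
    rw [dihedral_a_zpow ha hb hp] at hk
    have := congrArg ((b * a) ^ (k + 1)) hk
    rw [← Equiv.Perm.mul_apply, ← Equiv.Perm.mul_apply, ← zpow_add, ← zpow_add] at this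
    rw [show 2 * k + 1 = k + 1 + k by ring, ← this]
    simp
  have hi := key i hza
  have hj := key j hwa
  have hmul : ∀ m k : ℤ, ((b * a) ^ m) p = p → ((b * a) ^ (m * k)) p = p := by
    intro m k hm
    rw [zpow_mul]
    exact Equiv.Perm.zpow_apply_eq_self_of_apply_eq_self hm k
  have h2 := hmul _ i hj
  have h4 : ((b * a) ^ (i - j)) p = p := by
    rw [show i - j = (2 * i + 1) * (-j) + (2 * j + 1) * i by ring, zpow_add,
      Equiv.Perm.mul_apply, h2]
    exact hmul _ _ hi
  rw [show i = j + (i - j) by ring, zpow_add, Equiv.Perm.mul_apply, h4]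

theorem exists_fixed_mem_dihedralOrbit [Finite X] (ha : ∀ z, a (a z) = z) (hb : ∀ z, b (b z) = z)
    (hp : ∀ z, b z = z ↔ z = p) : ∃ z ∈ dihedralOrbit a b p, a z = z := by
  have hpp := (hp p).2 rfl
  set N := Function.minimalPeriod (b * a) p with hN
  have hNpos : 0 < N := Function.minimalPeriod_pos_of_mem_periodicPts
    ((b * a).injective.mem_periodicPts p)
  have hper : ((b * a) ^ (N : ℤ)) p = p := by
    rw [zpow_natCast, ← Equiv.Perm.iterate_eq_pow]
    exact Function.isPeriodicPt_minimalPeriod _ _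
  have hzp : ∀ i j : ℤ, i + N = j → ((b * a) ^ i) p = ((b * a) ^ j) p := by
    rintro i j rfl
    rw [zpow_add, Equiv.Perm.mul_apply, hper]
  rcases Nat.even_or_odd' N with ⟨i, hi | hi⟩
  · exfalso
    have h1 := dihedral_b_zpow ha hb hpp (i : ℤ)
    rw [hzp (-i) i (by omega), hp, zpow_natCast, ← Equiv.Perm.iterate_eq_pow] at h1
    have := Function.IsPeriodicPt.minimalPeriod_le (by omega) h1
    omega
  · refine ⟨_, ⟨i, rfl⟩, ?_⟩
    rw [dihedral_a_zpow ha hb hpp]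
    exact hzp _ _ (by omega)

end Dihedral

section SwapMap

variable {h : ℕ}

/-- The involution of `ZMod (2 * h + 1)` which fixes `p` and swaps `p + i` with `p + i + h` for
`1 ≤ i ≤ h`. -/
def swapMap (p z : ZMod (2 * h + 1)) : ZMod (2 * h + 1) :=
  if (z - p).val = 0 then z else if (z - p).val ≤ h then z + h else z - h

theorem two_mul_add_one_eq_zero : (h : ZMod (2 * h + 1)) + h + 1 = 0 := by
  have := ZMod.natCast_self (2 * h + 1)
  push_cast at this
  rw [← this]; ring

theorem sub_natCast_eq (z : ZMod (2 * h + 1)) : z - h = z + (h + 1 : ℕ) := by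
  have := two_mul_add_one_eq_zero (h := h)
  push_cast
  linear_combination -this

theorem val_sub_add_wrap (z u : ZMod (2 * h + 1)) (k : ℕ) (hk : k ≤ 2 * h + 1)
    (hk' : 2 * h + 1 ≤ (z - u).val + k) : (z + k - u).val = (z - u).val + k - (2 * h + 1) := by
  have h1 := ZMod.val_lt (z - u)
  have h2 : z + k - u = (((z - u).val + k - (2 * h + 1) : ℕ) : ZMod (2 * h + 1)) := by
    rw [Nat.cast_sub hk', ZMod.natCast_self]
    push_cast
    rw [ZMod.natCast_zmod_val]
    ring
  rw [h2, ZMod.val_natCast, Nat.mod_eq_of_lt (by omega)]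

theorem swapMap_of_pos {p z : ZMod (2 * h + 1)} (h0 : (z - p).val ≠ 0) (h1 : (z - p).val ≤ h) :
    swapMap p z = z + h := by simp [swapMap, h0, h1]

theorem swapMap_of_lt {p z : ZMod (2 * h + 1)} (h1 : h < (z - p).val) :
    swapMap p z = z - h := by
  rw [swapMap, if_neg (by omega), if_neg (by omega)]

theorem val_sub_eq_zero {n : ℕ} {p z : ZMod n} : (z - p).val = 0 ↔ z = p := by
  rw [ZMod.val_eq_zero, sub_eq_zero]

theorem val_swapMap_of_pos {p z : ZMod (2 * h + 1)} (h0 : (z - p).val ≠ 0)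
    (h1 : (z - p).val ≤ h) : (swapMap p z - p).val = (z - p).val + h := by
  rw [swapMap_of_pos h0 h1, ZMod.val_sub_add _ _ _ (by omega)]

theorem val_swapMap_of_lt {p z : ZMod (2 * h + 1)} (h1 : h < (z - p).val) :
    (swapMap p z - p).val = (z - p).val - h := by
  have := ZMod.val_lt (z - p)
  rw [swapMap_of_lt h1, sub_natCast_eq, val_sub_add_wrap _ _ _ (by omega) (by omega)]
  omega

@[simp] theorem swapMap_self (p : ZMod (2 * h + 1)) : swapMap p p = p := by simp [swapMap]

theorem swapMap_swapMap (p z : ZMod (2 * h + 1)) : swapMap p (swapMap p z) = z := by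
  have hlt := ZMod.val_lt (z - p)
  by_cases h0 : (z - p).val = 0
  · simp [swapMap, h0]
  by_cases h1 : (z - p).val ≤ h
  · have := val_swapMap_of_pos h0 h1
    rw [swapMap_of_lt (by omega), swapMap_of_pos h0 h1]
    ring
  · push Not at h1
    have := val_swapMap_of_lt h1
    rw [swapMap_of_pos (by omega) (by omega), swapMap_of_lt h1]
    ring

theorem swapMap_eq_self (p z : ZMod (2 * h + 1)) : swapMap p z = z ↔ z = p := by
  refine ⟨fun hz => ?_, by rintro rfl; simp⟩
  rw [← val_sub_eq_zero]
  have hlt := ZMod.val_lt (z - p)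
  by_contra h0
  by_cases h1 : (z - p).val ≤ h
  · have := val_swapMap_of_pos h0 h1
    rw [hz] at this
    omega
  · push Not at h1
    have := val_swapMap_of_lt h1
    rw [hz] at this
    omega

/-- `swapMap` as a permutation. -/
def swapPerm (p : ZMod (2 * h + 1)) : Equiv.Perm (ZMod (2 * h + 1)) :=
  ⟨swapMap p, swapMap p, swapMap_swapMap p, swapMap_swapMap p⟩

@[simp] theorem swapPerm_apply (p z : ZMod (2 * h + 1)) : swapPerm p z = swapMap p z := rfl

theorem swapMap_add_one (hh : 1 ≤ h) (p : ZMod (2 * h + 1)) :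
    swapMap p (p + 1) = p + 1 + h := by
  have h1 : ((p + 1) - p).val = 1 := by
    have := ZMod.val_sub_add p p 1 (by simp; omega)
    simpa using this
  exact swapMap_of_pos (by omega) (by omega)

theorem swapMap_add_one_self (hh : 1 ≤ h) (p : ZMod (2 * h + 1)) :
    swapMap (p + 1) p = p + 1 + h := by
  have h1 : (p - (p + 1)).val = 2 * h := by
    have h2 := ZMod.val_add_val_sub_comm (z := p + 1) (u := p) (by
      intro hp
      have := ZMod.val_sub_add p p 1 (by simp; omega)
      simp [hp] at this)
    have := ZMod.val_sub_add p p 1 (by simp; omega)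
    simp only [add_sub_cancel_left, sub_self, ZMod.val_zero, zero_add, Nat.cast_one] at this h2
    omega
  rw [swapMap_of_lt (by omega), sub_natCast_eq]
  push_cast; ring

theorem swapMap_succ_eq {p z : ZMod (2 * h + 1)} (h0 : z ≠ p) (h1 : z ≠ p + 1)
    (h2 : z ≠ p + 1 + h) : swapMap (p + 1) z = swapMap p z := by
  have hlt := ZMod.val_lt (z - p)
  have key : (z - (p + 1)).val + 1 = (z - p).val := by
    have := ZMod.val_sub_add z (p + 1) 1
    have hne := mt val_sub_eq_zero.1 h1
    have hlt := ZMod.val_lt (z - (p + 1))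
    rw [← this (by
      by_contra hc
      have := val_sub_add_wrap z (p + 1) 1 (by omega) (by omega)
      apply h0
      rw [← val_sub_eq_zero]
      convert this using 2
      · push_cast; ring
      · omega)]
    congr 1; push_cast; ring
  have hne := mt val_sub_eq_zero.1 h1
  have hne' : (z - (p + 1)).val ≠ h := by
    intro hc
    apply h2
    rw [ZMod.eq_add_val_sub z (p + 1), hc]
  by_cases hc : (z - p).val ≤ h
  · rw [swapMap_of_pos hne (by omega), swapMap_of_pos (by omega) hc]
  · rw [swapMap_of_lt (by omega), swapMap_of_lt (by omega)]

end SwapMap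

/-- The chords and cross ends of an odd circuit: `mate` joins the ends of a chord and fixes the
cross ends, which are labelled by `K` through `mark`. -/
structure OddSide (K : Type*) (h : ℕ) where
  mate : Equiv.Perm (ZMod (2 * h + 1))
  mate_mate : ∀ z, mate (mate z) = z
  mark : K → ZMod (2 * h + 1)
  mark_inj : Function.Injective mark
  mate_eq_self : ∀ z, mate z = z ↔ ∃ k, mark k = z

namespace OddSide

variable {K : Type*} {h : ℕ} (S : OddSide K h)

/-- The vertices of the path component of `p` in the union of the mate edges and the
near-perfect matching missing `p`. -/
def comp (p : ZMod (2 * h + 1)) : Set (ZMod (2 * h + 1)) := dihedralOrbit S.mate (swapPerm p) p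

theorem self_mem_comp (p) : p ∈ S.comp p := mem_dihedralOrbit_self

theorem mate_mem_comp {p z} (hz : z ∈ S.comp p) : S.mate z ∈ S.comp p :=
  a_mem_dihedralOrbit S.mate_mate (swapMap_swapMap p) (swapMap_self p) hz

theorem swapMap_mem_comp {p z} (hz : z ∈ S.comp p) : swapMap p z ∈ S.comp p :=
  b_mem_dihedralOrbit S.mate_mate (swapMap_swapMap p) (swapMap_self p) hz

theorem mate_mem_comp_iff {p z} : S.mate z ∈ S.comp p ↔ z ∈ S.comp p :=
  ⟨fun hz => by simpa [S.mate_mate] using S.mate_mem_comp hz, S.mate_mem_comp⟩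

theorem swapMap_mem_comp_iff {p z} : swapMap p z ∈ S.comp p ↔ z ∈ S.comp p :=
  ⟨fun hz => by simpa [swapMap_swapMap] using S.swapMap_mem_comp hz, S.swapMap_mem_comp⟩

theorem comp_subset {p} {T : Set (ZMod (2 * h + 1))} (hp : p ∈ T) (h1 : ∀ z ∈ T, S.mate z ∈ T)
    (h2 : ∀ z ∈ T, swapMap p z ∈ T) : S.comp p ⊆ T :=
  dihedralOrbit_subset S.mate_mate (swapMap_swapMap p) hp h1 h2

theorem exists_mark_mem_comp (p) : ∃ k, S.mark k ∈ S.comp p := by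
  obtain ⟨z, hz, hz'⟩ := exists_fixed_mem_dihedralOrbit (b := swapPerm p) S.mate_mate
    (swapMap_swapMap p) (swapMap_eq_self p)
  obtain ⟨k, rfl⟩ := (S.mate_eq_self z).1 hz'
  exact ⟨k, hz⟩

/-- The label of the unique cross end in `comp p`. -/
noncomputable def label (p : ZMod (2 * h + 1)) : K := (S.exists_mark_mem_comp p).choose

theorem mark_mem_comp_iff {p k} : S.mark k ∈ S.comp p ↔ S.label p = k := by
  have h1 : S.mark (S.label p) ∈ S.comp p := (S.exists_mark_mem_comp p).choose_spec
  refine ⟨fun hk => S.mark_inj ?_, by rintro rfl; exact h1⟩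
  exact dihedralOrbit_unique S.mate_mate (swapMap_swapMap p) (swapMap_self p) h1 hk
    ((S.mate_eq_self _).2 ⟨_, rfl⟩) ((S.mate_eq_self _).2 ⟨_, rfl⟩)

theorem comp_mark (k) : S.comp (S.mark k) = {S.mark k} := by
  apply subset_antisymm
  · refine S.comp_subset rfl ?_ ?_
    · rintro z rfl; exact (S.mate_eq_self _).2 ⟨_, rfl⟩
    · rintro z rfl; exact swapMap_self _
  · rintro z rfl; exact S.self_mem_comp _

theorem label_mark (k) : S.label (S.mark k) = k :=
  S.mark_mem_comp_iff.1 (S.self_mem_comp _)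

theorem label_succ_eq (hh : 1 ≤ h) {p}
    (hv : p + 1 + h ∈ S.comp p ∨ p + 1 + h ∈ S.comp (p + 1)) :
    S.label (p + 1) = S.label p := by
  have e1 := swapMap_add_one hh p
  have e1' : swapMap p (p + 1 + h) = p + 1 := by rw [← e1, swapMap_swapMap]
  have e2 := swapMap_add_one_self hh p
  have e2' : swapMap (p + 1) (p + 1 + (h : ZMod (2 * h + 1))) = p := by rw [← e2, swapMap_swapMap]
  rcases hv with hv | hv
  · have h1 : p + 1 ∈ S.comp p := e1' ▸ S.swapMap_mem_comp hv
    have h2 : S.comp (p + 1) ⊆ S.comp p := by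
      refine S.comp_subset h1 (fun z => S.mate_mem_comp) fun z hz => ?_
      by_cases z0 : z = p
      · subst z0; rwa [e2]
      by_cases z1 : z = p + 1
      · subst z1; rwa [swapMap_self]
      by_cases z2 : z = p + 1 + h
      · subst z2; rw [e2']; exact S.self_mem_comp p
      rw [swapMap_succ_eq z0 z1 z2]
      exact S.swapMap_mem_comp hz
    exact (S.mark_mem_comp_iff.1 (h2 (S.mark_mem_comp_iff.2 rfl))).symm
  · have h1 : p ∈ S.comp (p + 1) := by
      have := S.swapMap_mem_comp hv
      rwa [e2'] at this
    have h2 : S.comp p ⊆ S.comp (p + 1) := by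
      refine S.comp_subset h1 (fun z => S.mate_mem_comp) fun z hz => ?_
      by_cases z0 : z = p
      · subst z0; rwa [swapMap_self]
      by_cases z1 : z = p + 1
      · subst z1; rwa [e1]
      by_cases z2 : z = p + 1 + h
      · subst z2; rw [e1']; exact S.self_mem_comp _
      rw [← swapMap_succ_eq z0 z1 z2]
      exact S.swapMap_mem_comp hz
    exact S.mark_mem_comp_iff.1 (h2 (S.mark_mem_comp_iff.2 rfl))

theorem comp_disjoint (hh : 1 ≤ h) {p}
    (hv : p + 1 + h ∉ S.comp p) (hv' : p + 1 + h ∉ S.comp (p + 1)) :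
    Disjoint (S.comp p) (S.comp (p + 1)) := by
  have e1 := swapMap_add_one hh p
  have e2 := swapMap_add_one_self hh p
  have hp1 : p + 1 ∉ S.comp p := fun hc => hv (e1 ▸ S.swapMap_mem_comp hc)
  have hp : p ∉ S.comp (p + 1) := fun hc => hv' (e2 ▸ S.swapMap_mem_comp hc)
  have h2 : S.comp (p + 1) ⊆ S.comp (p + 1) \ S.comp p := by
    refine S.comp_subset ⟨S.self_mem_comp _, hp1⟩ (fun z hz => ⟨S.mate_mem_comp hz.1,
      fun hc => hz.2 (S.mate_mem_comp_iff.1 hc)⟩) fun z hz => ⟨S.swapMap_mem_comp hz.1, ?_⟩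
    by_cases z1 : z = p + 1
    · subst z1; rwa [swapMap_self]
    rw [swapMap_succ_eq (by rintro rfl; exact hp hz.1) z1 (by rintro rfl; exact hv' hz.1)]
    exact fun hc => hz.2 (S.swapMap_mem_comp_iff.1 hc)
  exact Set.disjoint_left.2 fun z hz hz' => (h2 hz').2 hz

theorem notMem_of_label_ne (hh : 1 ≤ h) {p} (hl : S.label p ≠ S.label (p + 1)) :
    p + 1 + h ∉ S.comp p ∧ p + 1 + h ∉ S.comp (p + 1) :=
  ⟨fun hc => hl (S.label_succ_eq hh (.inl hc)).symm,
    fun hc => hl (S.label_succ_eq hh (.inr hc)).symm⟩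

theorem mem_of_label_eq (hh : 1 ≤ h) {p} (hl : S.label p = S.label (p + 1)) :
    p + 1 + h ∈ S.comp p ∨ p + 1 + h ∈ S.comp (p + 1) := by
  by_contra! hc
  have := S.comp_disjoint hh hc.1 hc.2
  exact Set.disjoint_left.1 this (S.mark_mem_comp_iff.2 rfl) (S.mark_mem_comp_iff.2 hl.symm)

/-- The pattern of `p` covers the circuit edge joining `u` and `u + h`. -/
def Covers (p u : ZMod (2 * h + 1)) : Prop := h < (p - u).val ∧ u ∉ S.comp p

theorem covers_mark {k u} (hu : h < (S.mark k - u).val) : S.Covers (S.mark k) u := by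
  refine ⟨hu, ?_⟩
  rw [comp_mark]
  rintro rfl
  simp at hu

theorem covers_or_covers (hh : 1 ≤ h) {p u} (hl : S.label p ≠ S.label (p + 1))
    (hu : h ≤ (p - u).val) : S.Covers p u ∨ S.Covers (p + 1) u := by
  obtain ⟨hv, hv'⟩ := S.notMem_of_label_ne hh hl
  have hlt := ZMod.val_lt (p - u)
  by_cases hu1 : u = p + 1
  · left
    subst hu1
    refine ⟨?_, fun hc => hv (swapMap_add_one hh p ▸ S.swapMap_mem_comp hc)⟩
    by_contra hc
    have h1 : (p - (p + 1)).val = h := by omega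
    have h2 := ZMod.eq_add_val_sub p (p + 1)
    rw [h1, add_assoc, add_comm (1 : ZMod _), left_eq_add] at h2
    have h3 : ((h + 1 : ℕ) : ZMod (2 * h + 1)).val = h + 1 := by
      rw [ZMod.val_natCast, Nat.mod_eq_of_lt (by omega)]
    push_cast at h3
    rw [h2] at h3
    simp at h3
  have h2h : (p - u).val ≠ 2 * h := by
    intro hc
    have h2 := ZMod.eq_add_val_sub p u
    rw [hc] at h2
    apply hu1
    have := two_mul_add_one_eq_zero (h := h)
    push_cast at h2
    linear_combination (-1) * h2 - this
  have h1 := ZMod.val_sub_add p u 1 (by omega)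
  push_cast at h1
  by_cases hm : (p - u).val = h
  · right
    refine ⟨by omega, fun hc => hv' ?_⟩
    have h2 := ZMod.eq_add_val_sub p u
    rw [hm] at h2
    have := two_mul_add_one_eq_zero (h := h)
    have h3 : u = p + 1 + h := by linear_combination (-1) * h2 - this
    rwa [← h3]
  · by_cases hm : u ∈ S.comp p
    · exact .inr ⟨by omega, Set.disjoint_left.1 (S.comp_disjoint hh hv hv') hm⟩
    · exact .inl ⟨by omega, hm⟩

/-- There are patterns with labels `a, b, c, d` which together cover all circuit edges. -/
def Cov (a b c d : K) : Prop := ∃ p q r s, S.label p = a ∧ S.label q = b ∧ S.label r = c ∧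
  S.label s = d ∧ ∀ u, S.Covers p u ∨ S.Covers q u ∨ S.Covers r u ∨ S.Covers s u

/-- The label of the pattern `q + h`. -/
noncomputable def shiftLabel (q : ZMod (2 * h + 1)) : K := S.label (q + h)

theorem shiftLabel_mark_of_eq (hh : 1 ≤ h) {k}
    (hk : S.shiftLabel (S.mark k) = S.shiftLabel (S.mark k + 1)) : S.shiftLabel (S.mark k) = k := by
  have h1 : S.mark k + 1 + h = S.mark k + h + 1 := by ring
  have h2 : S.mark k + h + 1 + h = S.mark k := by
    linear_combination two_mul_add_one_eq_zero (h := h)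
  rw [shiftLabel, shiftLabel, h1] at hk
  have := S.mem_of_label_eq hh hk
  rw [h2, S.mark_mem_comp_iff, S.mark_mem_comp_iff, ← hk, or_self] at this
  exact this

theorem cov_transition (hh : 1 ≤ h) {i j d r} (hij : S.mark j = S.mark i + (d : ℕ)) (hd : d ≤ h)
    (hr : r ≤ d) (hne : S.shiftLabel (S.mark i + (r : ℕ)) ≠ S.shiftLabel (S.mark i + (r : ℕ) + 1)) :
    S.Cov (S.shiftLabel (S.mark i + (r : ℕ))) (S.shiftLabel (S.mark i + (r : ℕ) + 1)) i j := by
  have h1 : S.mark i + (r : ℕ) + 1 + h = S.mark i + (r + h : ℕ) + 1 := by push_cast; ring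
  have h2 : S.mark i + (r : ℕ) + h = S.mark i + (r + h : ℕ) := by push_cast; ring
  rw [shiftLabel, shiftLabel, h1, h2] at hne ⊢
  refine ⟨_, _, S.mark i, S.mark j, rfl, rfl, S.label_mark i, S.label_mark j, fun u => ?_⟩
  by_cases ht : h < (S.mark i - u).val
  · exact .inr (.inr (.inl (S.covers_mark ht)))
  by_cases ht' : h < (S.mark i - u).val + d
  · refine .inr (.inr (.inr (S.covers_mark ?_)))
    rw [hij, ZMod.val_sub_add _ _ _ (by omega)]
    exact ht'
  · rw [← or_assoc]
    refine .inl (S.covers_or_covers hh hne ?_)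
    rw [ZMod.val_sub_add _ _ _ (by omega)]
    omega

theorem cov_open (hh : 1 ≤ h) {i} (l : K)
    (hne : S.shiftLabel (S.mark i) ≠ S.shiftLabel (S.mark i + 1)) :
    S.Cov (S.shiftLabel (S.mark i)) (S.shiftLabel (S.mark i + 1)) i l := by
  have h1 : S.mark i + 1 + h = S.mark i + h + 1 := by ring
  rw [shiftLabel, shiftLabel, h1] at hne ⊢
  refine ⟨_, _, S.mark i, S.mark l, rfl, rfl, S.label_mark i, S.label_mark l, fun u => ?_⟩
  by_cases ht : h < (S.mark i - u).val
  · exact .inr (.inr (.inl (S.covers_mark ht)))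
  · rw [← or_assoc]
    refine .inl (S.covers_or_covers hh hne ?_)
    rw [ZMod.val_sub_add _ _ _ (by omega)]
    omega

theorem cov_marks {i j k l : K} (hu : ∀ u, h < (S.mark i - u).val ∨ h < (S.mark j - u).val ∨
    h < (S.mark k - u).val ∨ h < (S.mark l - u).val) : S.Cov i j k l :=
  ⟨S.mark i, S.mark j, S.mark k, S.mark l, S.label_mark i, S.label_mark j, S.label_mark k,
    S.label_mark l, fun u => (hu u).imp S.covers_mark
      (Or.imp S.covers_mark (Or.imp S.covers_mark S.covers_mark))⟩

end OddSide

namespace OddSide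

variable {K : Type*} {h : ℕ} (S : OddSide K h)

variable {S} in
theorem Cov.swap_fst {a b c d : K} (hc : S.Cov a b c d) : S.Cov b a c d := by
  obtain ⟨p, q, r, s, hp, hq, hr, hs, hu⟩ := hc
  exact ⟨q, p, r, s, hq, hp, hr, hs, fun u => by have := hu u; tauto⟩

variable {S} in
theorem Cov.swap_mid {a b c d : K} (hc : S.Cov a b c d) : S.Cov a c b d := by
  obtain ⟨p, q, r, s, hp, hq, hr, hs, hu⟩ := hc
  exact ⟨p, r, q, s, hp, hr, hq, hs, fun u => by have := hu u; tauto⟩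

variable {S} in
theorem Cov.swap_lst {a b c d : K} (hc : S.Cov a b c d) : S.Cov a b d c := by
  obtain ⟨p, q, r, s, hp, hq, hr, hs, hu⟩ := hc
  exact ⟨p, q, s, r, hp, hq, hs, hr, fun u => by have := hu u; tauto⟩

/-- The three marks `i, j, k` do not lie on a common half of the circuit. -/
def Balanced (i j k : K) : Prop :=
  ∀ u, h < (S.mark i - u).val ∨ h < (S.mark j - u).val ∨ h < (S.mark k - u).val

variable {S} in
theorem Balanced.cov {i j k a b c d : K} (hb : S.Balanced i j k)
    (hi : i = a ∨ i = b ∨ i = c ∨ i = d) (hj : j = a ∨ j = b ∨ j = c ∨ j = d)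
    (hk : k = a ∨ k = b ∨ k = c ∨ k = d) : S.Cov a b c d := by
  refine S.cov_marks fun u => ?_
  have := hb u
  rcases this with hu | hu | hu
  · rcases hi with rfl | rfl | rfl | rfl <;> tauto
  · rcases hj with rfl | rfl | rfl | rfl <;> tauto
  · rcases hk with rfl | rfl | rfl | rfl <;> tauto

theorem exists_balanced [Finite K] {A : Set K} (hA : ∀ u, ∃ k ∈ A, h < (S.mark k - u).val)
    {e : K} (he : e ∈ A) : ∃ s ∈ A, ∃ t ∈ A, S.Balanced e s t := by
  obtain ⟨t, ⟨htA, hth⟩, hmax⟩ := Set.exists_max_image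
    {k ∈ A | (S.mark e - S.mark k).val ≤ h} (fun k => (S.mark e - S.mark k).val)
    (Set.toFinite _) ⟨e, he, by simp⟩
  obtain ⟨s, hsA, hs⟩ := hA (S.mark t)
  refine ⟨s, hsA, t, htA, fun u => ?_⟩
  set w := (S.mark e - S.mark t).val with hw
  set v := (S.mark s - S.mark t).val with hv
  have hvlt : v < 2 * h + 1 := ZMod.val_lt _
  have he' : S.mark e = S.mark t + (w : ℕ) := ZMod.eq_add_val_sub _ _
  have hs' : S.mark s = S.mark t + (v : ℕ) := ZMod.eq_add_val_sub _ _
  have hse : S.mark s = S.mark e + (v - w : ℕ) := by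
    rw [hs', he', Nat.cast_sub (by omega)]
    ring
  have hse' : (S.mark s - S.mark e).val = v - w := by
    have := ZMod.val_sub_add (S.mark e) (S.mark e) (v - w) (by simp; omega)
    rw [hse, this]
    simp
  have hne : S.mark s ≠ S.mark e := by
    intro hc
    rw [hc] at hse'
    simp at hse'
    omega
  have hes := ZMod.val_add_val_sub_comm hne
  have hvw : v - w ≤ h := by
    by_contra hc
    have := hmax s ⟨hsA, by omega⟩
    omega
  by_cases h0 : h < (S.mark t - u).val
  · exact .inr (.inr h0)
  have h1 : (S.mark e - u).val = (S.mark t - u).val + w := by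
    rw [he', ZMod.val_sub_add _ _ _ (by omega)]
  by_cases h2 : h < (S.mark e - u).val
  · exact .inl h2
  have h3 : (S.mark s - u).val = (S.mark t - u).val + v := by
    rw [hs', ZMod.val_sub_add _ _ _ (by omega)]
  exact .inr (.inl (by omega))

variable {S} in
theorem Balanced.swap {i j k : K} (hb : S.Balanced i j k) : S.Balanced i k j :=
  fun u => by have := hb u; tauto

/-- Either some four labels work for both sides, or `S₂` is balanced by `s₁, s₂, t₂`. -/
theorem Balanced.exchange {h₁ h₂ : ℕ} [Finite K] {S₁ : OddSide K h₁} {S₂ : OddSide K h₂}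
    {e s₁ t₁ s₂ t₂ : K} (hb₁ : S₁.Balanced e s₁ t₁) (hb₂ : S₂.Balanced e s₂ t₂) :
    (∃ a b c d, S₁.Cov a b c d ∧ S₂.Cov a b c d) ∨ S₂.Balanced s₁ s₂ t₂ := by
  obtain ⟨s, hs, t, ht, hb⟩ := S₂.exists_balanced (A := {e, s₁, t₁, s₂, t₂}) (e := s₁)
    (fun u => by
      rcases hb₂ u with hu | hu | hu
      exacts [⟨e, by simp, hu⟩, ⟨s₂, by simp, hu⟩, ⟨t₂, by simp, hu⟩]) (by simp)
  have key1 : (s = e ∨ s = s₁ ∨ s = t₁) → ∃ a b c d, S₁.Cov a b c d ∧ S₂.Cov a b c d :=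
    fun hs' => ⟨e, s₁, t₁, t, hb₁.cov (by simp) (by simp) (by simp),
      hb.cov (by simp) (by tauto) (by simp)⟩
  have key2 : (t = e ∨ t = s₁ ∨ t = t₁ ∨ t = s) → ∃ a b c d, S₁.Cov a b c d ∧ S₂.Cov a b c d :=
    fun ht' => ⟨e, s₁, t₁, s, hb₁.cov (by simp) (by simp) (by simp),
      hb.cov (by simp) (by simp) (by tauto)⟩
  rcases hs with hs | hs | hs | rfl | rfl
  · exact .inl (key1 (.inl hs))
  · exact .inl (key1 (.inr (.inl hs)))
  · exact .inl (key1 (.inr (.inr hs)))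
  all_goals
    rcases ht with ht | ht | ht | rfl | rfl
    · exact .inl (key2 (.inl ht))
    · exact .inl (key2 (.inr (.inl ht)))
    · exact .inl (key2 (.inr (.inr (.inl ht))))
  · exact .inl (key2 (by simp))
  · exact .inr hb
  · exact .inr hb.swap
  · exact .inl (key2 (by simp))

theorem exists_cov_of_balanced {h₁ h₂ : ℕ} [Finite K] {S₁ : OddSide K h₁} {S₂ : OddSide K h₂}
    (hb₁ : ∀ u, ∃ k, h₁ < (S₁.mark k - u).val) (hb₂ : ∀ u, ∃ k, h₂ < (S₂.mark k - u).val) :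
    ∃ a b c d, S₁.Cov a b c d ∧ S₂.Cov a b c d := by
  obtain ⟨e, -⟩ := hb₁ 0
  obtain ⟨s₁, -, t₁, -, h1⟩ := S₁.exists_balanced (A := Set.univ) (e := e)
    (fun u => by simpa using hb₁ u) trivial
  obtain ⟨s₂, -, t₂, -, h2⟩ := S₂.exists_balanced (A := Set.univ) (e := e)
    (fun u => by simpa using hb₂ u) trivial
  rcases h1.exchange h2 with hc | h3
  · exact hc
  rcases h2.exchange h1 with ⟨a, b, c, d, h4, h5⟩ | h4
  · exact ⟨a, b, c, d, h5, h4⟩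
  exact ⟨s₁, t₁, s₂, t₂, h4.cov (by simp) (by simp) (by simp), h3.cov (by simp) (by simp) (by simp)⟩

/-- Every label other than `m` lies on one of the two flanks `R`, `L` of `m`, and on each nonempty
flank there is a transition from `m` to some label `b`. -/
structure Flanked (Cov : K → K → K → K → Prop) (m : K) (R L : K → Prop) : Prop where
  or_of_ne : ∀ c, c ≠ m → R c ∨ L c
  right : (∃ c, R c) → ∃ b, b ≠ m ∧ (∀ c, R c → Cov m b m c) ∧ ∀ i j, L i → R j → Cov m b i j
  left : (∃ c, L c) → ∃ b, b ≠ m ∧ (∀ c, L c → Cov m b m c) ∧ ∀ i j, L i → R j → Cov m b i j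

variable {S} in
theorem Flanked.symm {m : K} {R L : K → Prop} (hF : Flanked S.Cov m R L) :
    Flanked S.Cov m L R where
  or_of_ne c hc := (hF.or_of_ne c hc).symm
  right hc := by
    obtain ⟨b, hb, h1, h2⟩ := hF.left hc
    exact ⟨b, hb, h1, fun i j hi hj => (h2 j i hj hi).swap_lst⟩
  left hc := by
    obtain ⟨b, hb, h1, h2⟩ := hF.right hc
    exact ⟨b, hb, h1, fun i j hi hj => (h2 j i hj hi).swap_lst⟩

section TwoSides

variable {h₁ h₂ : ℕ} {S₁ : OddSide K h₁} {S₂ : OddSide K h₂}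

theorem exists_cov_of_flanked_of_right {m b : K} {R L U D : K → Prop}
    (hF₁ : Flanked S₁.Cov m R L) (hF₂ : Flanked S₂.Cov m U D) (hbm : b ≠ m) (hbU : U b)
    (hb : ∀ c, R c → S₁.Cov m b m c) : ∃ a b c d, S₁.Cov a b c d ∧ S₂.Cov a b c d := by
  obtain ⟨d, hdm, hd1, hd2⟩ := hF₂.right ⟨b, hbU⟩
  rcases hF₁.or_of_ne d hdm with hdR | hdL
  · exact ⟨m, b, m, d, hb d hdR, (hd1 b hbU).swap_mid.swap_lst.swap_mid⟩
  obtain ⟨b', hbm', hb1', hb2'⟩ := hF₁.left ⟨d, hdL⟩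
  rcases hF₂.or_of_ne b' hbm' with hbU' | hbD'
  · exact ⟨m, b', m, d, hb1' d hdL, (hd1 b' hbU').swap_mid.swap_lst.swap_mid⟩
  obtain ⟨d', hdm', hd1', hd2'⟩ := hF₂.left ⟨b', hbD'⟩
  rcases hF₁.or_of_ne d' hdm' with hdR' | hdL'
  · rcases hF₁.or_of_ne b hbm with hbR | hbL
    · exact ⟨m, b', d, b, hb2' _ _ hdL hbR, (hd2 _ _ hbD' hbU).swap_mid⟩
    · exact ⟨m, b', b, d', hb2' _ _ hbL hdR', (hd2' _ _ hbD' hbU).swap_mid.swap_lst⟩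
  · exact ⟨m, b', m, d', hb1' d' hdL', (hd1' b' hbD').swap_mid.swap_lst.swap_mid⟩

theorem exists_cov_of_flanked {m : K} {R L U D : K → Prop} (hF₁ : Flanked S₁.Cov m R L)
    (hF₂ : Flanked S₂.Cov m U D) (hne : ∃ c, c ≠ m) :
    ∃ a b c d, S₁.Cov a b c d ∧ S₂.Cov a b c d := by
  obtain ⟨c, hc⟩ := hne
  wlog hR : R c generalizing R L
  · exact this hF₁.symm ((hF₁.or_of_ne c hc).resolve_left hR)
  obtain ⟨b, hb, hb1, -⟩ := hF₁.right ⟨c, hR⟩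
  rcases hF₂.or_of_ne b hb with hU | hD
  · exact exists_cov_of_flanked_of_right hF₁ hF₂ hb hU hb1
  · exact exists_cov_of_flanked_of_right hF₁ hF₂.symm hb hD hb1

end TwoSides

theorem exists_mark_eq_add (i j : K) :
    ∃ d ≤ h, S.mark j = S.mark i + (d : ℕ) ∨ S.mark i = S.mark j + (d : ℕ) := by
  by_cases hij : S.mark j = S.mark i
  · exact ⟨0, by omega, by simp [hij]⟩
  have := ZMod.val_add_val_sub_comm hij
  by_cases hd : (S.mark j - S.mark i).val ≤ h
  · exact ⟨_, hd, .inl (ZMod.eq_add_val_sub _ _)⟩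
  · exact ⟨(S.mark i - S.mark j).val, by omega, .inr (ZMod.eq_add_val_sub _ _)⟩

theorem balanced_of_add {i m j : K} {d d' : ℕ} (hd : d ≤ h) (hd' : d' ≤ h)
    (hm : S.mark m = S.mark i + (d' : ℕ)) (hj : S.mark j = S.mark m + (d : ℕ)) (hlt : h < d' + d) :
    S.Balanced i m j := by
  intro u
  by_cases h0 : h < (S.mark i - u).val
  · exact .inl h0
  have h1 : (S.mark m - u).val = (S.mark i - u).val + d' := by
    rw [hm, ZMod.val_sub_add _ _ _ (by omega)]
  by_cases h2 : h < (S.mark m - u).val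
  · exact .inr (.inl h2)
  have h3 : (S.mark j - u).val = (S.mark m - u).val + d := by
    rw [hj, ZMod.val_sub_add _ _ _ (by omega)]
  exact .inr (.inr (by omega))

theorem cov_transition_of_lt (hh : 1 ≤ h) {i m j : K} {d d' r : ℕ} (hd : d ≤ h) (hd' : d' ≤ h)
    (hm : S.mark m = S.mark i + (d' : ℕ)) (hj : S.mark j = S.mark m + (d : ℕ)) (hr : r ≤ d' + d)
    {a b : K} (ha : S.shiftLabel (S.mark i + (r : ℕ)) = a)
    (hb : S.shiftLabel (S.mark i + (r : ℕ) + 1) = b) (hab : a ≠ b) (hmab : m = a ∨ m = b) :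
    S.Cov a b i j := by
  by_cases hlt : h < d' + d
  · exact (S.balanced_of_add hd hd' hm hj hlt).cov (by simp) (by tauto) (by simp)
  · subst ha hb
    refine S.cov_transition hh (d := d' + d) ?_ (by omega) hr hab
    rw [hj, hm]; push_cast; ring

theorem flanked (hh : 1 ≤ h) {m : K} (h0 : S.shiftLabel (S.mark m) = m)
    (h1 : S.shiftLabel (S.mark m + 1) = m) :
    Flanked S.Cov m (fun c => c ≠ m ∧ ∃ d ≤ h, S.mark c = S.mark m + (d : ℕ))
      (fun c => c ≠ m ∧ ∃ d ≤ h, S.mark m = S.mark c + (d : ℕ)) where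
  or_of_ne c hc := by
    obtain ⟨d, hd, h2⟩ := S.exists_mark_eq_add m c
    exact h2.imp (fun h2 => ⟨hc, d, hd, h2⟩) (fun h2 => ⟨hc, d, hd, h2⟩)
  right := by
    rintro ⟨c₀, hc₀⟩
    have hex : ∀ c, c ≠ m → ∀ d : ℕ, S.mark c = S.mark m + (d : ℕ) →
        ∃ r ≤ d, S.shiftLabel (S.mark m + (r : ℕ) + 1) ≠ m := by
      intro c hc d hcd
      by_contra! hcon
      have e2 := hcon d le_rfl
      have e1 : S.shiftLabel (S.mark m + (d : ℕ)) = m := by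
        rcases d with _ | d
        · simpa using h0
        · have := hcon d (by omega)
          rwa [show S.mark m + ((d + 1 : ℕ) : ZMod (2 * h + 1)) = S.mark m + d + 1 by
            push_cast; ring]
      rw [← hcd] at e1 e2
      exact hc ((S.shiftLabel_mark_of_eq hh (e1.trans e2.symm)).symm.trans e1)
    have hex' : ∃ r : ℕ, S.shiftLabel (S.mark m + (r : ℕ) + 1) ≠ m := by
      obtain ⟨hne, d, -, hd⟩ := hc₀
      obtain ⟨r, -, hr⟩ := hex _ hne d hd
      exact ⟨r, hr⟩
    classical
    set r := Nat.find hex' with hrdef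
    have hr : S.shiftLabel (S.mark m + (r : ℕ) + 1) ≠ m := Nat.find_spec hex'
    have hr0 : S.shiftLabel (S.mark m + (r : ℕ)) = m := by
      rcases hr' : r with _ | r'
      · simpa using h0
      · have := Nat.find_min hex' (m := r') (by omega)
        push Not at this
        rwa [show S.mark m + ((r' + 1 : ℕ) : ZMod (2 * h + 1)) = S.mark m + r' + 1 by
            push_cast; ring]
    have hle : ∀ c, c ≠ m → ∀ d : ℕ, S.mark c = S.mark m + (d : ℕ) → r ≤ d := by
      intro c hc d hd
      obtain ⟨r', hr', h2⟩ := hex c hc d hd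
      exact (Nat.find_min' hex' h2).trans hr'
    refine ⟨_, hr, ?_, ?_⟩
    · rintro c ⟨hc, d, hd, hcd⟩
      have := S.cov_transition hh hcd hd (hle c hc d hcd) (by rw [hr0]; exact hr.symm)
      rwa [hr0] at this
    · rintro i j ⟨hi, d', hd', hid⟩ ⟨hj, d, hd, hjd⟩
      have hrd := hle j hj d hjd
      have e1 : S.mark i + ((d' + r : ℕ) : ZMod (2 * h + 1)) = S.mark m + (r : ℕ) := by
        rw [hid]; push_cast; ring
      refine S.cov_transition_of_lt hh (r := d' + r) hd hd' hid hjd (by omega) ?_ ?_ hr.symm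
        (.inl rfl)
      · rw [e1, hr0]
      · rw [e1]
  left := by
    rintro ⟨c₀, hc₀⟩
    have hex : ∀ c, c ≠ m → ∀ d : ℕ, S.mark m = S.mark c + (d : ℕ) →
        ∃ r ≤ d, S.shiftLabel (S.mark m - (r : ℕ)) ≠ m := by
      intro c hc d hcd
      by_contra! hcon
      have e2 := hcon d le_rfl
      have e1 : S.shiftLabel (S.mark m - (d : ℕ) + 1) = m := by
        rcases d with _ | d
        · simpa using h1
        · have := hcon d (by omega)
          rwa [show S.mark m - ((d + 1 : ℕ) : ZMod (2 * h + 1)) + 1 = S.mark m - d by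
            push_cast; ring]
      rw [hcd, add_sub_cancel_right] at e1 e2
      exact hc ((S.shiftLabel_mark_of_eq hh (e2.trans e1.symm)).symm.trans e2)
    have hex' : ∃ r : ℕ, S.shiftLabel (S.mark m - (r : ℕ)) ≠ m := by
      obtain ⟨hne, d, -, hd⟩ := hc₀
      obtain ⟨r, -, hr⟩ := hex _ hne d hd
      exact ⟨r, hr⟩
    classical
    set r := Nat.find hex' with hrdef
    have hr : S.shiftLabel (S.mark m - (r : ℕ)) ≠ m := Nat.find_spec hex'
    have hr0 : S.shiftLabel (S.mark m - (r : ℕ) + 1) = m := by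
      rcases hr' : r with _ | r'
      · simpa using h1
      · have := Nat.find_min hex' (m := r') (by omega)
        push Not at this
        rwa [show S.mark m - ((r' + 1 : ℕ) : ZMod (2 * h + 1)) + 1 = S.mark m - r' by
            push_cast; ring]
    have hle : ∀ c, c ≠ m → ∀ d : ℕ, S.mark m = S.mark c + (d : ℕ) → r ≤ d := by
      intro c hc d hd
      obtain ⟨r', hr', h2⟩ := hex c hc d hd
      exact (Nat.find_min' hex' h2).trans hr'
    have e1 : ∀ c, c ≠ m → ∀ d : ℕ, S.mark m = S.mark c + (d : ℕ) →
        S.mark c + ((d - r : ℕ) : ZMod (2 * h + 1)) = S.mark m - (r : ℕ) := by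
      intro c hc d hd
      rw [Nat.cast_sub (hle c hc d hd), hd]; ring
    refine ⟨_, hr, ?_, ?_⟩
    · rintro c ⟨hc, d, hd, hcd⟩
      have := S.cov_transition hh hcd hd (r := d - r) (by omega)
        (by rw [e1 c hc d hcd, hr0]; exact hr)
      rw [e1 c hc d hcd, hr0] at this
      exact this.swap_fst.swap_lst
    · rintro i j ⟨hi, d', hd', hid⟩ ⟨hj, d, hd, hjd⟩
      refine (S.cov_transition_of_lt hh (r := d' - r) hd hd' hid hjd (by omega) ?_ ?_ hr
        (.inr rfl)).swap_fst
      · rw [e1 i hi d' hid]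
      · rw [e1 i hi d' hid, hr0]

end OddSide

theorem exists_step_across {K : Type*} (y : K → ℕ) (c : ℕ → K) {q D : ℕ}
    (hc : (y (c 0) ≤ q ∧ q ≤ y (c D)) ∨ (q ≤ y (c 0) ∧ y (c D) ≤ q)) (hne : ∃ t ≤ D, c t ≠ c 0) :
    ∃ t < D, c t ≠ c (t + 1) ∧
      ((y (c t) ≤ q ∧ q ≤ y (c (t + 1))) ∨ (y (c (t + 1)) ≤ q ∧ q ≤ y (c t))) := by
  by_contra! hcon
  rcases lt_trichotomy (y (c 0)) q with h0 | h0 | h0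
  · have : ∀ t ≤ D, y (c t) < q := by
      intro t
      induction t with
      | zero => intro _; exact h0
      | succ t ih =>
        intro ht
        have h1 := ih (by omega)
        by_cases h2 : c t = c (t + 1)
        · rwa [← h2]
        · have := (hcon t (by omega) h2).1 (by omega)
          omega
    have := this D le_rfl
    omega
  · obtain ⟨t, ht, hne⟩ := hne
    apply hne
    clear hne
    induction t with
    | zero => rfl
    | succ t ih =>
      have h1 := ih (by omega)
      by_cases h2 : c t = c (t + 1)
      · rw [← h2, h1]
      · have h3 := (hcon t (by omega) h2).1
        have h4 := (hcon t (by omega) h2).2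
        rw [h1] at h3 h4
        omega
  · have : ∀ t ≤ D, q < y (c t) := by
      intro t
      induction t with
      | zero => intro _; exact h0
      | succ t ih =>
        intro ht
        have h1 := ih (by omega)
        by_cases h2 : c t = c (t + 1)
        · rwa [← h2]
        · have := (hcon t (by omega) h2).2
          omega
    have := this D le_rfl
    omega

theorem exists_step_of_mem {K : Type*} (g : ℕ → K) {m q M : ℕ} (hm : m ≤ q) (hM : q ≤ M)
    (hne : ∃ r, m ≤ r ∧ r ≤ M ∧ g r ≠ g q) :
    ∃ r, m ≤ r ∧ r < M ∧ g r ≠ g (r + 1) ∧ (g r = g q ∨ g (r + 1) = g q) := by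
  by_contra! hcon
  have key : ∀ t, m + t ≤ M → (g (m + t) = g q ↔ g m = g q) := by
    intro t
    induction t with
    | zero => intro _; rfl
    | succ t ih =>
      intro ht
      rw [← ih (by omega)]
      by_cases h1 : g (m + t) = g (m + t + 1)
      · rw [h1, add_assoc]
      · have := hcon (m + t) (by omega) (by omega) h1
        rw [← add_assoc]
        tauto
  obtain ⟨r, h1, h2, h3⟩ := hne
  have e1 := key (q - m) (by omega)
  have e2 := key (r - m) (by omega)
  rw [Nat.add_sub_cancel' (by omega)] at e1 e2
  exact h3 (e2.2 (e1.1 rfl))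

namespace OddSide

variable {K : Type*} {h : ℕ} (S : OddSide K h)

theorem cov_transition_between (hh : 1 ≤ h) {u : ZMod (2 * h + 1)}
    (hu : ∀ k, (S.mark k - u).val ≤ h) {i j : K} {r : ℕ} (hi : (S.mark i - u).val ≤ r)
    (hj : r ≤ (S.mark j - u).val)
    (hne : S.shiftLabel (u + (r : ℕ)) ≠ S.shiftLabel (u + (r : ℕ) + 1)) :
    S.Cov (S.shiftLabel (u + (r : ℕ))) (S.shiftLabel (u + (r : ℕ) + 1)) i j := by
  have := hu j
  have e1 : u + (r : ZMod (2 * h + 1)) = S.mark i + ((r - (S.mark i - u).val : ℕ)) := by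
    rw [Nat.cast_sub hi, ZMod.natCast_zmod_val]
    ring
  have e2 : S.mark j = S.mark i + (((S.mark j - u).val - (S.mark i - u).val : ℕ)) := by
    rw [Nat.cast_sub (by omega)]
    simp
  rw [e1] at hne ⊢
  exact S.cov_transition hh e2 (by omega) (by omega) hne

variable {h₁ h₂ : ℕ} {S₁ : OddSide K h₁} {S₂ : OddSide K h₂}

theorem exists_cov_of_half (hh₁ : 1 ≤ h₁) (hh₂ : 1 ≤ h₂) (hK : ∀ m : K, ∃ c, c ≠ m)
    {u : ZMod (2 * h₂ + 1)} (hu : ∀ k, (S₂.mark k - u).val ≤ h₂) :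
    ∃ a b c d, S₁.Cov a b c d ∧ S₂.Cov a b c d := by
  set y : K → ℕ := fun k => (S₂.mark k - u).val with hy
  have hyeq : ∀ k, S₂.mark k = u + (y k : ℕ) := fun k => ZMod.eq_add_val_sub _ _
  have hyinj : ∀ i j, y i = y j → i = j := fun i j hij => S₂.mark_inj (by
    rw [hyeq i, hyeq j, hij])
  set g : ℕ → K := fun q => S₂.shiftLabel (u + (q : ℕ)) with hg
  have hg1 : ∀ q, S₂.shiftLabel (u + (q : ℕ) + 1) = g (q + 1) := by
    intro q
    simp only [hg]
    congr 1
    push_cast; ring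
  have hgc : ∀ k, g (y k) = g (y k + 1) → g (y k) = k := by
    intro k hk
    rw [← hg1] at hk
    simp only [hg, ← hyeq] at hk ⊢
    exact S₂.shiftLabel_mark_of_eq hh₂ hk
  have hgcov : ∀ i j r, y i ≤ r → r ≤ y j → g r ≠ g (r + 1) → S₂.Cov (g r) (g (r + 1)) i j := by
    intro i j r hi hj hne
    have := S₂.cov_transition_between hh₂ hu hi hj (by rw [hg1]; exact hne)
    rwa [hg1] at this
  -- a transition of the second circuit at a position separating the two labels around `i`
  have hsep : ∀ q i a b, g q = i → a ≠ b → y a < q → q ≤ y b →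
      (∀ l, S₁.Cov a b i l) → ∃ a b c d, S₁.Cov a b c d ∧ S₂.Cov a b c d := by
    rintro q _ a b rfl hab ha hb hcov
    obtain ⟨r, hr1, hr2, hr3, hr4⟩ := exists_step_of_mem g (m := y a) (q := q) (M := y b + 1)
      (by omega) (by omega) (by
        by_contra! hcon
        have e1 := hgc a ((hcon (y a) le_rfl (by omega)).trans
          (hcon (y a + 1) (by omega) (by omega)).symm)
        have e2 := hgc b ((hcon (y b) (by omega) (by omega)).trans
          (hcon (y b + 1) (by omega) (by omega)).symm)
        rw [hcon (y a) le_rfl (by omega)] at e1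
        rw [hcon (y b) (by omega) (by omega)] at e2
        exact hab (e1.symm.trans e2))
    have h2 := hgcov a b r hr1 (by omega) hr3
    rcases hr4 with hr4 | hr4
    · rw [hr4] at h2
      exact ⟨a, b, g q, _, hcov _, h2.swap_mid.swap_fst.swap_lst.swap_mid⟩
    · rw [hr4] at h2
      exact ⟨a, b, g q, _, hcov _, h2.swap_fst.swap_mid.swap_fst.swap_lst.swap_mid⟩
  by_cases hcase : ∃ q, (y (S₁.shiftLabel (S₁.mark (g q))) < q ∧
      q ≤ y (S₁.shiftLabel (S₁.mark (g q) + 1))) ∨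
      (y (S₁.shiftLabel (S₁.mark (g q) + 1)) < q ∧ q ≤ y (S₁.shiftLabel (S₁.mark (g q))))
  · obtain ⟨q, hq⟩ := hcase
    have hne : S₁.shiftLabel (S₁.mark (g q)) ≠ S₁.shiftLabel (S₁.mark (g q) + 1) := by
      intro hc
      rw [hc] at hq
      omega
    rcases hq with ⟨ha, hb⟩ | ⟨ha, hb⟩
    · exact hsep q _ _ _ rfl hne ha hb fun l => S₁.cov_open hh₁ l hne
    · exact hsep q _ _ _ rfl hne.symm ha hb
        fun l => (S₁.cov_open hh₁ l hne).swap_fst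
  push Not at hcase
  obtain ⟨q, hq, hq'⟩ : ∃ q, q ≤ y (S₁.shiftLabel (S₁.mark (g q))) ∧
      y (S₁.shiftLabel (S₁.mark (g (q + 1)))) < q + 1 := by
    by_contra! hcon
    have : ∀ q, q ≤ y (S₁.shiftLabel (S₁.mark (g q))) := by
      intro q
      induction q with
      | zero => omega
      | succ q ih => exact hcon q ih
    have h1 := this (h₂ + 1)
    have h2 : y (S₁.shiftLabel (S₁.mark (g (h₂ + 1)))) ≤ h₂ := hu _
    omega
  have hq1 : q ≤ y (S₁.shiftLabel (S₁.mark (g q) + 1)) := by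
    by_contra hc
    have := (hcase q).2 (by omega)
    omega
  have hq1' : y (S₁.shiftLabel (S₁.mark (g (q + 1)) + 1)) < q + 1 := by
    by_contra hc
    have := (hcase (q + 1)).1 hq'
    omega
  by_cases hij : g q = g (q + 1)
  · rw [← hij] at hq' hq1'
    set m := g q with hm
    have e0 : S₁.shiftLabel (S₁.mark m) = S₁.shiftLabel (S₁.mark m + 1) := hyinj _ _ (by omega)
    have e1 := S₁.shiftLabel_mark_of_eq hh₁ e0
    have e2 : y m = q := by rw [e1] at hq hq'; omega
    refine exists_cov_of_flanked (S₁.flanked hh₁ e1 (e0 ▸ e1)) (S₂.flanked (m := m) hh₂ ?_ ?_) (hK m)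
    · rw [hyeq, e2]
    · rw [hyeq, e2, hg1, ← hij]
  -- a transition of the first circuit across `q`
  have hmain : ∀ i j (d : ℕ), d ≤ h₁ → i ≠ j → S₁.mark j = S₁.mark i + (d : ℕ) →
      ((y (S₁.shiftLabel (S₁.mark i)) ≤ q ∧ q ≤ y (S₁.shiftLabel (S₁.mark j + 1))) ∨
        (q ≤ y (S₁.shiftLabel (S₁.mark i)) ∧ y (S₁.shiftLabel (S₁.mark j + 1)) ≤ q)) →
      ∃ a b, S₁.Cov a b i j ∧ y a ≤ q ∧ q ≤ y b := by
    intro i j d hd hij hjd hy'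
    set c : ℕ → K := fun t => S₁.shiftLabel (S₁.mark i + (t : ℕ)) with hc
    have hc0 : c 0 = S₁.shiftLabel (S₁.mark i) := by simp [hc]
    have hcs : ∀ t, S₁.shiftLabel (S₁.mark i + (t : ℕ) + 1) = c (t + 1) := by
      intro t
      simp only [hc]
      congr 1
      push_cast; ring
    have hc1 : c 1 = S₁.shiftLabel (S₁.mark i + 1) := by simp [hc]
    have hcd : c d = S₁.shiftLabel (S₁.mark j) := by simp [hc, hjd]
    have hcd1 : c (d + 1) = S₁.shiftLabel (S₁.mark j + 1) := by rw [← hcs, hjd]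
    have hd0 : d ≠ 0 := by
      rintro rfl
      exact hij (S₁.mark_inj (by simpa using hjd.symm))
    rw [← hc0, ← hcd1] at hy'
    obtain ⟨t, ht, hne, hyt⟩ := exists_step_across y c hy' (by
      by_contra! hcon
      have e1 := S₁.shiftLabel_mark_of_eq hh₁ (k := i) (by
        rw [← hc0, ← hc1, hcon 1 (by omega)])
      have e2 := S₁.shiftLabel_mark_of_eq hh₁ (k := j) (by
        rw [← hcd, ← hcd1, hcon d (by omega), hcon (d + 1) (by omega)])
      rw [← hc0] at e1
      rw [← hcd, hcon d (by omega)] at e2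
      exact hij (e1.symm.trans e2))
    have hcov := S₁.cov_transition hh₁ hjd hd (r := t) (by omega) (by rw [hcs]; exact hne)
    rw [hcs] at hcov
    rcases hyt with hyt | hyt
    · exact ⟨_, _, hcov, hyt⟩
    · exact ⟨_, _, hcov.swap_fst, hyt⟩
  obtain ⟨a, b, hcov, ha, hb⟩ : ∃ a b, S₁.Cov a b (g q) (g (q + 1)) ∧ y a ≤ q ∧ q ≤ y b := by
    obtain ⟨d, hd, hd' | hd'⟩ := S₁.exists_mark_eq_add (g q) (g (q + 1))
    · exact hmain _ _ d hd hij hd' (by omega)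
    · obtain ⟨a, b, hcov, hab⟩ := hmain _ _ d hd (Ne.symm hij) hd' (by omega)
      exact ⟨a, b, hcov.swap_lst, hab⟩
  exact ⟨a, b, _, _, hcov, (hgcov a b q ha hb hij).swap_mid.swap_fst.swap_lst.swap_mid⟩

theorem exists_common_cov [Finite K] (hh₁ : 1 ≤ h₁) (hh₂ : 1 ≤ h₂) (hK : ∀ m : K, ∃ c, c ≠ m) :
    ∃ a b c d, S₁.Cov a b c d ∧ S₂.Cov a b c d := by
  by_cases h1 : ∀ u, ∃ k, h₁ < (S₁.mark k - u).val
  · by_cases h2 : ∀ u, ∃ k, h₂ < (S₂.mark k - u).val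
    · exact exists_cov_of_balanced h1 h2
    · push Not at h2
      obtain ⟨u, hu⟩ := h2
      exact exists_cov_of_half hh₁ hh₂ hK hu
  · push Not at h1
    obtain ⟨u, hu⟩ := h1
    obtain ⟨a, b, c, d, h3, h4⟩ := exists_cov_of_half (S₁ := S₂) hh₂ hh₁ hK hu
    exact ⟨a, b, c, d, h4, h3⟩

end OddSide

theorem exists_involution {D : Type*} (R : D → D → Prop) (hs : ∀ x y, R x y → R y x)
    (hu : ∀ x, ∃! y, R x y) :
    ∃ a : Equiv.Perm D, (∀ x, a (a x) = x) ∧ ∀ x y, R x y ↔ y = a x := by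
  choose f hf hf' using hu
  have hff : ∀ x, f (f x) = x := fun x => (hf' _ _ (hs _ _ (hf x))).symm
  exact ⟨⟨f, f, hff, hff⟩, hff, fun x y => ⟨hf' x y, by rintro rfl; exact hf x⟩⟩

theorem zpow_apply_ne_of_involutions {D : Type*} {a b : Equiv.Perm D} (ha : ∀ z, a (a z) = z)
    (hb : ∀ z, b (b z) = z) (ha' : ∀ z, a z ≠ z) (hb' : ∀ z, b z ≠ z) (z : D) (m : ℤ) :
    ((b * a) ^ m) z ≠ b z := by
  intro hm
  have haa : a⁻¹ = a := by ext w; rw [Equiv.Perm.inv_eq_iff_eq, ha]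
  have hbb : b⁻¹ = b := by ext w; rw [Equiv.Perm.inv_eq_iff_eq, hb]
  have hconj : ∀ k : ℤ, b * (b * a) ^ k = (b * a) ^ (-k) * b := by
    intro k
    have : b * (b * a) ^ k * b⁻¹ = (b * a) ^ (-k) := by
      rw [← conj_zpow, zpow_neg, ← inv_zpow]
      congr 1
      rw [mul_inv_rev, haa, hbb]
      ext w; simp [hb]
    rw [← this, mul_assoc, inv_mul_cancel, mul_one]
  have hconj' : ∀ k : ℤ, a * (b * a) ^ k = (b * a) ^ (-k) * a := by
    intro k
    have : a * (b * a) ^ k * a⁻¹ = (b * a) ^ (-k) := by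
      rw [← conj_zpow, zpow_neg, ← inv_zpow]
      congr 1
      rw [mul_inv_rev, haa, hbb]
      ext w; simp [ha]
    rw [← this, mul_assoc, inv_mul_cancel, mul_one]
  rcases Int.even_or_odd' m with ⟨k, rfl | rfl⟩
  · apply hb' (((b * a) ^ k) z)
    rw [← Equiv.Perm.mul_apply, hconj, Equiv.Perm.mul_apply, ← hm, ← Equiv.Perm.mul_apply,
      ← zpow_add]
    congr 2; ring
  · apply ha' (((b * a) ^ k) z)
    have hz : a z = ((b * a) ^ (2 * k)) z := by
      have h1 : a z = b (((b * a) ^ (1 : ℤ)) z) := by simp [hb]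
      rw [h1, ← Equiv.Perm.mul_apply, hconj, Equiv.Perm.mul_apply, ← hm, ← Equiv.Perm.mul_apply,
        ← zpow_add]
      congr 2; ring
    rw [← Equiv.Perm.mul_apply, hconj', Equiv.Perm.mul_apply, hz, ← Equiv.Perm.mul_apply,
      ← zpow_add]
    congr 2; ring

namespace Multigraph

variable {V E : Type*} (G : Multigraph V E)

/-- `C` is traversed by the vertices `c u` and the edges `e u`, the edge `e u` joining `c u`
and `c (u + k)`. -/
structure Traversal (C : Set E) (n : ℕ) (k : ZMod n) where
  c : ZMod n → V
  e : ZMod n → E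
  c_inj : Function.Injective c
  range_c : Set.range c = G.supp C
  e_inj : Function.Injective e
  range_e : Set.range e = C
  inc_e : ∀ u, G.inc (e u) = s(c u, c (u + k))

variable {G}

theorem exists_other_end {e : E} {v : V} (hv : v ∈ G.inc e) : ∃ w, w ≠ v ∧ G.inc e = s(v, w) := by
  obtain ⟨w, hw⟩ := hv
  refine ⟨w, ?_, hw⟩
  rintro rfl
  exact G.no_loops e (by rw [hw]; simp)

theorem IsCircuit.exists_traversal [Finite V] [Finite E] {C : Set E} (hC : G.IsCircuit C) :
    ∃ n, 2 ≤ n ∧ Nonempty (G.Traversal C n 1) := by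
  obtain ⟨⟨e₀, he₀⟩, hdeg, hreach⟩ := hC
  let D := {p : V × E // p.2 ∈ C ∧ p.1 ∈ G.inc p.2}
  obtain ⟨a, ha, haR⟩ := exists_involution (fun x y : D => x.1.2 = y.1.2 ∧ x ≠ y)
    (fun x y hxy => ⟨hxy.1.symm, hxy.2.symm⟩) (by
      rintro ⟨⟨v, e⟩, he, hv⟩
      obtain ⟨w, hw, hwe⟩ := exists_other_end hv
      refine ⟨⟨(w, e), he, by rw [hwe]; simp⟩, ⟨rfl, ?_⟩, ?_⟩
      · intro hc
        exact hw (congrArg (fun d : D => d.1.1) hc).symm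
      · rintro ⟨⟨v', e'⟩, he', hv'⟩ ⟨h1, h2⟩
        simp only at h1 hv' hwe
        subst h1
        rw [hwe, Sym2.mem_iff] at hv'
        rcases hv' with rfl | rfl
        · exact absurd rfl h2
        · rfl)
  obtain ⟨b, hb, hbR⟩ := exists_involution (fun x y : D => x.1.1 = y.1.1 ∧ x ≠ y)
    (fun x y hxy => ⟨hxy.1.symm, hxy.2.symm⟩) (by
      rintro ⟨⟨v, e⟩, he, hv⟩
      have h2 := hdeg v ⟨e, he, hv⟩
      rw [deg, Set.ncard_eq_two] at h2
      obtain ⟨x, y, hxy, hset⟩ := h2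
      have hmem : ∀ f, (f ∈ C ∧ v ∈ G.inc f) ↔ f = x ∨ f = y := fun f => by
        have := Set.ext_iff.1 hset f
        simpa using this
      obtain ⟨f, hf, hfe, hall⟩ : ∃ f, (f ∈ C ∧ v ∈ G.inc f) ∧ f ≠ e ∧
          ∀ f', (f' ∈ C ∧ v ∈ G.inc f') → f' ≠ e → f' = f := by
        rcases (hmem e).1 ⟨he, hv⟩ with rfl | rfl
        · exact ⟨y, (hmem y).2 (.inr rfl), hxy.symm,
            fun f' hf' hne => ((hmem f').1 hf').resolve_left hne⟩
        · exact ⟨x, (hmem x).2 (.inl rfl), hxy,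
            fun f' hf' hne => ((hmem f').1 hf').resolve_right hne⟩
      refine ⟨⟨(v, f), hf⟩, ⟨rfl, ?_⟩, ?_⟩
      · intro hc
        exact hfe (congrArg (fun d : D => d.1.2) hc).symm
      · rintro ⟨⟨v', e'⟩, he', hv'⟩ ⟨h1, h2⟩
        simp only at h1 hv' he'
        subst h1
        have := hall e' ⟨he', hv'⟩ (by rintro rfl; exact h2 rfl)
        subst this
        rfl)
  have ha' : ∀ z, a z ≠ z := fun z => ((haR z (a z)).2 rfl).2.symm
  have hb' : ∀ z, b z ≠ z := fun z => ((hbR z (b z)).2 rfl).2.symm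
  have hae : ∀ z, (a z).1.2 = z.1.2 := fun z => ((haR z (a z)).2 rfl).1.symm
  have hbv : ∀ z, (b z).1.1 = z.1.1 := fun z => ((hbR z (b z)).2 rfl).1.symm
  obtain ⟨d₀⟩ : Nonempty D := by
    obtain ⟨⟨v, w⟩, hvw⟩ := Quot.exists_rep (G.inc e₀)
    exact ⟨⟨(v, e₀), he₀, by
      rw [← hvw]; exact Sym2.mem_mk_left v w⟩⟩
  set n := Function.minimalPeriod ((b * a) • ·) d₀ with hn
  have hnpos : 0 < n := Function.minimalPeriod_pos_of_mem_periodicPts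
    ((b * a).injective.mem_periodicPts d₀)
  have : NeZero n := ⟨hnpos.ne'⟩
  let F : ℤ → D := fun k => ((b * a) ^ k) d₀
  have hF0 : ∀ k : ℤ, F k = d₀ ↔ (n : ℤ) ∣ k := fun k =>
    MulAction.zpow_smul_eq_iff_minimalPeriod_dvd (a := b * a) (b := d₀)
  have hFadd : ∀ k l : ℤ, F (k + l) = ((b * a) ^ k) (F l) := fun k l => by
    simp only [F]; rw [zpow_add, Equiv.Perm.mul_apply]
  have hF : ∀ k l : ℤ, F k = F l ↔ (k : ZMod n) = l := by
    intro k l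
    have h0 : (k : ZMod n) = l ↔ F (k - l) = d₀ := by
      rw [← sub_eq_zero, ← Int.cast_sub, ZMod.intCast_zmod_eq_zero_iff_dvd, hF0]
    rw [h0]
    have h1 := hFadd l (k - l)
    rw [add_sub_cancel] at h1
    have h2 := hFadd l 0
    rw [add_zero] at h2
    have h3 : F 0 = d₀ := by simp [F]
    rw [h1, h2, h3]
    exact (((b * a) ^ l).injective).eq_iff
  have hF1 : ∀ k, F (k + 1) = b (a (F k)) := fun k => by
    rw [add_comm, hFadd, zpow_one]; rfl
  have hFb : ∀ k l, F k ≠ b (F l) := fun k l hc => by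
    apply zpow_apply_ne_of_involutions ha hb ha' hb' (F l) (k - l)
    rw [← hFadd, sub_add_cancel, hc]
  have hFa : ∀ k l, F k ≠ a (F l) := fun k l hc => by
    apply hFb (l + 1) k
    rw [hF1, ← hc]
  have hv : ∀ k l, (F k).1.1 = (F l).1.1 → F k = F l := by
    intro k l hkl
    by_contra hne
    exact hFb l k ((hbR _ _).1 ⟨hkl, hne⟩)
  have he : ∀ k l, (F k).1.2 = (F l).1.2 → F k = F l := by
    intro k l hkl
    by_contra hne
    exact hFa l k ((haR _ _).1 ⟨hkl, hne⟩)
  have hcast : ∀ i : ZMod n, (((i.cast : ℤ)) : ZMod n) = i := ZMod.intCast_zmod_cast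
  have hFc : ∀ k : ℤ, F ((k : ZMod n).cast : ℤ) = F k := fun k => (hF _ _).2 (hcast _)
  have hinc : ∀ k, G.inc (F k).1.2 = s((F k).1.1, (F (k + 1)).1.1) := by
    intro k
    rw [hF1, hbv]
    have h1 := (F k).2.2
    have h2 := (a (F k)).2.2
    rw [hae] at h2
    have h3 : (F k).1.1 ≠ (a (F k)).1.1 := fun hc =>
      ha' (F k) (Subtype.ext (Prod.ext hc.symm (hae _)))
    exact (Sym2.mem_and_mem_iff h3).1 ⟨h1, h2⟩
  have hedge : ∀ k, ∀ f ∈ C, (F k).1.1 ∈ G.inc f → ∃ l, f = (F l).1.2 := by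
    intro k f hf hkf
    by_cases h1 : F k = ⟨((F k).1.1, f), hf, hkf⟩
    · exact ⟨k, by rw [h1]⟩
    · have h2 := (hbR (F k) ⟨((F k).1.1, f), hf, hkf⟩).1 ⟨rfl, h1⟩
      have h3 := hF1 (k - 1)
      rw [sub_add_cancel] at h3
      have h4 : b (F k) = a (F (k - 1)) := by rw [h3, hb]
      rw [h4] at h2
      refine ⟨k - 1, ?_⟩
      rw [← hae, ← h2]
  have hsupp : ∀ v ∈ G.supp C, ∃ k, v = (F k).1.1 := by
    intro v hvC
    have h1 := hreach (F 0).1.1 ⟨_, (F 0).2.1, (F 0).2.2⟩ v hvC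
    induction h1 with
    | refl => exact ⟨0, rfl⟩
    | tail _ h2 ih =>
      obtain ⟨f, hf, hff⟩ := h2
      obtain ⟨k, rfl⟩ := ih ⟨f, hf, by rw [hff]; simp⟩
      obtain ⟨l, rfl⟩ := hedge k f hf (by rw [hff]; simp)
      have h3 := hinc l
      rw [hff, Sym2.eq_iff] at h3
      rcases h3 with ⟨-, h3⟩ | ⟨-, h3⟩
      · exact ⟨_, h3⟩
      · exact ⟨_, h3⟩
  refine ⟨n, ?_, ⟨⟨fun i => (F (i.cast : ℤ)).1.1, fun i => (F (i.cast : ℤ)).1.2,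
    fun i j hij => ?_, ?_, fun i j hij => ?_, ?_, fun i => ?_⟩⟩⟩
  · by_contra hlt
    have h1 : n = 1 := by omega
    have h2 : F 1 = F 0 := (hF 1 0).2 (by
      have : Subsingleton (ZMod n) := by rw [h1]; infer_instance
      exact Subsingleton.elim _ _)
    have h3 := hinc 0
    rw [zero_add, h2] at h3
    exact G.no_loops _ (by rw [h3]; simp)
  · rw [← hcast i, ← hcast j]
    exact (hF _ _).1 (hv _ _ hij)
  · ext v
    constructor
    · rintro ⟨i, rfl⟩
      exact ⟨_, (F _).2.1, (F _).2.2⟩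
    · intro hvC
      obtain ⟨k, rfl⟩ := hsupp v hvC
      exact ⟨(k : ZMod n), by simp only [hFc]⟩
  · rw [← hcast i, ← hcast j]
    exact (hF _ _).1 (he _ _ hij)
  · ext f
    constructor
    · rintro ⟨i, rfl⟩
      exact (F _).2.1
    · intro hf
      obtain ⟨⟨v, w⟩, hvw⟩ := Quot.exists_rep (G.inc f)
      have hvf : v ∈ G.inc f := by rw [← hvw]; exact Sym2.mem_mk_left v w
      obtain ⟨k, rfl⟩ := hsupp v ⟨f, hf, hvf⟩
      obtain ⟨l, rfl⟩ := hedge k f hf hvf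
      exact ⟨(l : ZMod n), by simp only [hFc]⟩
  · have h1 : F ((i + 1).cast : ℤ) = F ((i.cast : ℤ) + 1) := (hF _ _).2 (by
      rw [hcast, Int.cast_add, hcast, Int.cast_one])
    simp only [h1]
    exact hinc _

theorem bijective_two_mul_sub (h : ℕ) (a : ZMod (2 * h + 1)) :
    Function.Bijective fun u : ZMod (2 * h + 1) => 2 * u - a := by
  have h0 : 2 * (h : ZMod (2 * h + 1)) = -1 := by
    have := ZMod.natCast_self (2 * h + 1)
    push_cast at this
    linear_combination this
  refine ⟨fun x y hxy => ?_, fun y => ⟨(-h) * (y + a), ?_⟩⟩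
  · simp only at hxy
    linear_combination (-h) * hxy + (x - y) * h0
  · simp only
    linear_combination (-(y + a)) * h0

/-- Reindexing an odd circuit so that consecutive vertices differ by `h`. -/
def Traversal.double {C : Set E} {h : ℕ} (T : G.Traversal C (2 * h + 1) 1) :
    G.Traversal C (2 * h + 1) h where
  c u := T.c (2 * u - 0)
  e u := T.e (2 * u - 1)
  c_inj := T.c_inj.comp (bijective_two_mul_sub h 0).1
  range_c := by
    rw [← T.range_c]
    exact (bijective_two_mul_sub h 0).2.range_comp T.c
  e_inj := T.e_inj.comp (bijective_two_mul_sub h 1).1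
  range_e := by
    conv_rhs => rw [← T.range_e]
    exact (bijective_two_mul_sub h 1).2.range_comp T.e
  inc_e u := by
    rw [T.inc_e, Sym2.eq_swap]
    have := ZMod.natCast_self (2 * h + 1)
    push_cast at this
    have h1 : 2 * u - 1 + 1 = 2 * u - 0 := by ring
    have h2 : 2 * u - 1 = 2 * (u + h) - 0 := by linear_combination -this
    rw [h1, h2]

end Multigraph

namespace Multigraph

variable {V E : Type*} {G : Multigraph V E}

variable (G) in
/-- The edges outside `C` form a perfect matching: `edge v` is the one at `v`, and it joins `v`
and `partner v`. -/
structure CoMatching (C : Set E) where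
  partner : V → V
  edge : V → E
  partner_partner : ∀ v, partner (partner v) = v
  inc_edge : ∀ v, G.inc (edge v) = s(v, partner v)
  edge_notMem : ∀ v, edge v ∉ C
  eq_edge : ∀ e ∉ C, ∀ v ∈ G.inc e, e = edge v

namespace CoMatching

variable {C : Set E} (X : G.CoMatching C)

theorem mem_inc_edge (v : V) : v ∈ G.inc (X.edge v) := by rw [X.inc_edge]; simp

theorem partner_ne (v : V) : X.partner v ≠ v := fun hv =>
  G.no_loops (X.edge v) (by rw [X.inc_edge, hv]; simp)

theorem partner_injective : Function.Injective X.partner :=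
  Function.Involutive.injective X.partner_partner

theorem eq_or_eq_of_edge_eq {v w : V} (hvw : X.edge v = X.edge w) : v = w ∨ v = X.partner w := by
  have := X.mem_inc_edge v
  rwa [hvw, X.inc_edge, Sym2.mem_iff] at this

theorem even_card [Finite V] (X : G.CoMatching C) : Even (Nat.card V) := by
  classical
  have := Fintype.ofFinite V
  have h2 := Equiv.Perm.card_fixedPoints_modEq (p := 2) (n := 1)
    (f := X.partner) (funext fun v => X.partner_partner v)
  have h3 : IsEmpty (Function.fixedPoints X.partner) := ⟨fun v => X.partner_ne _ v.2⟩
  rw [Fintype.card_eq_zero (α := Function.fixedPoints X.partner)] at h2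
  rw [Nat.card_eq_fintype_card, Nat.even_iff]
  exact h2

/-- A set of vertices closed under `partner` and a set of edges that perfectly matches the
remaining vertices yield a perfect matching. -/
theorem isPM_union {J : Set V} {A : Set E} (hJ : ∀ v ∈ J, X.partner v ∈ J)
    (hv : ∀ v, (v ∈ J ∧ ∀ e ∈ A, v ∉ G.inc e) ∨ (v ∉ J ∧ ∃! e, e ∈ A ∧ v ∈ G.inc e)) :
    G.IsPM (X.edge '' J ∪ A) := by
  refine ⟨Set.subset_univ _, fun _ _ _ _ => Set.mem_univ _, fun v _ => ?_⟩
  have hmem : ∀ e ∈ X.edge '' J, v ∈ G.inc e → e = X.edge v ∧ v ∈ J := by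
    rintro _ ⟨w, hw, rfl⟩ hvw
    have h1 := X.eq_edge _ (X.edge_notMem w) v hvw
    refine ⟨h1, ?_⟩
    rcases X.eq_or_eq_of_edge_eq h1.symm with rfl | rfl
    · exact hw
    · exact hJ _ hw
  rcases hv v with ⟨h1, h2⟩ | ⟨h1, e, ⟨he, hve⟩, hu⟩
  · refine ⟨X.edge v, ⟨.inl ⟨v, h1, rfl⟩, X.mem_inc_edge v⟩, ?_⟩
    rintro e ⟨he | he, hve⟩
    · exact (hmem e he hve).1
    · exact absurd hve (h2 e he)
  · refine ⟨e, ⟨.inr he, hve⟩, ?_⟩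
    rintro e' ⟨he' | he', hve'⟩
    · exact absurd (hmem e' he' hve').2 h1
    · exact hu e' ⟨he', hve'⟩

theorem isPM_compl (X : G.CoMatching C) : G.IsPM Cᶜ := by
  refine ⟨Set.subset_univ _, fun _ _ _ _ => Set.mem_univ _, fun v _ => ?_⟩
  exact ⟨X.edge v, ⟨X.edge_notMem v, X.mem_inc_edge v⟩, fun e he => X.eq_edge e he.1 v he.2⟩

end CoMatching

theorem deg_union_eq_two {C1 C2 : Set E} (hC1 : G.IsCircuit C1)
    (hdisj : G.supp C1 ∩ G.supp C2 = ∅) {v : V} (hv : v ∈ G.supp C1) :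
    G.deg (C1 ∪ C2) v = 2 := by
  rw [← hC1.2.1 v hv, deg, deg]
  congr 1
  ext e
  refine ⟨fun he => ⟨he.1.resolve_right fun h2 => ?_, he.2⟩, fun he => ⟨.inl he.1, he.2⟩⟩
  exact Set.eq_empty_iff_forall_notMem.1 hdisj v ⟨hv, e, h2, he.2⟩

theorem IsCubic.nonempty_coMatching [Finite E] (hG : G.IsCubic) {C : Set E}
    (hC : ∀ v, G.deg C v = 2) : Nonempty (G.CoMatching C) := by
  have hex : ∀ v, ∃! e, e ∉ C ∧ v ∈ G.inc e := by
    intro v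
    have h1 := hG v
    have h2 := hC v
    rw [deg] at h1 h2
    have h3 := Set.ncard_sdiff_add_ncard_of_subset
      (s := {e ∈ C | v ∈ G.inc e}) (t := {e ∈ Set.univ | v ∈ G.inc e})
      (fun e he => ⟨Set.mem_univ e, he.2⟩) (Set.toFinite _)
    rw [h1, h2] at h3
    obtain ⟨e, he⟩ := Set.ncard_eq_one.1 (Nat.add_right_cancel (m := 2) (k := 1) h3)
    have hmem : ∀ f, (f ∉ C ∧ v ∈ G.inc f) ↔ f = e := fun f => by
      have := Set.ext_iff.1 he f
      simp only [Set.mem_sdiff, Set.mem_ofPred_eq, Set.mem_univ, true_and,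
        Set.mem_singleton_iff] at this
      rw [← this]
      tauto
    exact ⟨e, (hmem e).2 rfl, fun f hf => (hmem f).1 hf⟩
  choose f hf hfu using hex
  choose m hm hmf using fun v => exists_other_end (hf v).2
  have hfm : ∀ v, f (m v) = f v := fun v =>
    (hfu (m v) (f v) ⟨(hf v).1, by rw [hmf]; simp⟩).symm
  refine ⟨⟨m, f, fun v => ?_, hmf, fun v => (hf v).1, fun e he v hv => hfu v e ⟨he, hv⟩⟩⟩
  have h1 := hmf (m v)
  rw [hfm, hmf, Sym2.eq_swap] at h1
  exact (Sym2.congr_right.1 h1).symm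

namespace Traversal

variable {C : Set E} {n : ℕ} {k : ZMod n} (T : G.Traversal C n k)

theorem mem_inc_e {j u : ZMod n} : T.c j ∈ G.inc (T.e u) ↔ u = j ∨ u = j - k := by
  rw [T.inc_e, Sym2.mem_iff, T.c_inj.eq_iff, T.c_inj.eq_iff, eq_comm, eq_comm (a := j),
    eq_sub_iff_add_eq]

/-- Every index `j` satisfies exactly one of `j ∈ J`, `j ∈ A` and `j - k ∈ A`. -/
def IsPattern (k : ZMod n) (J A : Set (ZMod n)) : Prop :=
  ∀ j, (j ∈ J ∧ j ∉ A ∧ j - k ∉ A) ∨ (j ∉ J ∧ j ∈ A ∧ j - k ∉ A) ∨ (j ∉ J ∧ j ∉ A ∧ j - k ∈ A)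

theorem IsPattern.local_matching {J A : Set (ZMod n)} (hp : IsPattern k J A) (j : ZMod n) :
    (j ∈ J ∧ ∀ e ∈ T.e '' A, T.c j ∉ G.inc e) ∨
      (j ∉ J ∧ ∃! e, e ∈ T.e '' A ∧ T.c j ∈ G.inc e) := by
  rcases hp j with ⟨h1, h2, h3⟩ | ⟨h1, h2, h3⟩ | ⟨h1, h2, h3⟩
  · refine .inl ⟨h1, ?_⟩
    rintro _ ⟨u, hu, rfl⟩ hc
    rcases T.mem_inc_e.1 hc with rfl | rfl
    · exact h2 hu
    · exact h3 hu
  · refine .inr ⟨h1, T.e j, ⟨⟨j, h2, rfl⟩, T.mem_inc_e.2 (.inl rfl)⟩, ?_⟩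
    rintro _ ⟨⟨u, hu, rfl⟩, hc⟩
    rcases T.mem_inc_e.1 hc with rfl | rfl
    · rfl
    · exact absurd hu h3
  · refine .inr ⟨h1, T.e (j - k), ⟨⟨j - k, h3, rfl⟩, T.mem_inc_e.2 (.inr rfl)⟩, ?_⟩
    rintro _ ⟨⟨u, hu, rfl⟩, hc⟩
    rcases T.mem_inc_e.1 hc with rfl | rfl
    · exact absurd hu h2
    · rfl

theorem image_e_subset (A : Set (ZMod n)) : T.e '' A ⊆ C := by
  conv_rhs => rw [← T.range_e]
  exact Set.image_subset_range _ _

theorem c_mem_supp (u : ZMod n) : T.c u ∈ G.supp C := T.range_c ▸ Set.mem_range_self u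

theorem exists_c_eq {v : V} (hv : v ∈ G.supp C) : ∃ u, T.c u = v := by
  rwa [← T.range_c] at hv

theorem exists_e_eq {e : E} (he : e ∈ C) : ∃ u, T.e u = e := by
  rwa [← T.range_e] at he

end Traversal

variable {C1 C2 : Set E} {n₁ n₂ : ℕ} {k₁ : ZMod n₁} {k₂ : ZMod n₂}

theorem card_eq_add (T₁ : G.Traversal C1 n₁ k₁) (T₂ : G.Traversal C2 n₂ k₂)
    (hdisj : G.supp C1 ∩ G.supp C2 = ∅) (hspan : G.supp C1 ∪ G.supp C2 = Set.univ)
    [NeZero n₁] [NeZero n₂] : Nat.card V = n₁ + n₂ := by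
  have hb : Function.Bijective (Sum.elim T₁.c T₂.c) := by
    refine ⟨T₁.c_inj.sumElim T₂.c_inj fun a b hab => ?_, fun v => ?_⟩
    · exact Set.eq_empty_iff_forall_notMem.1 hdisj (T₁.c a)
        ⟨T₁.c_mem_supp a, hab ▸ T₂.c_mem_supp b⟩
    · rcases hspan.symm ▸ Set.mem_univ v with hv | hv
      · obtain ⟨u, rfl⟩ := T₁.exists_c_eq hv
        exact ⟨.inl u, rfl⟩
      · obtain ⟨u, rfl⟩ := T₂.exists_c_eq hv
        exact ⟨.inr u, rfl⟩
  rw [← Nat.card_eq_of_bijective _ hb, Nat.card_sum, Nat.card_zmod, Nat.card_zmod]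

theorem isPM_of_isPattern (X : G.CoMatching (C1 ∪ C2)) (T₁ : G.Traversal C1 n₁ k₁)
    (T₂ : G.Traversal C2 n₂ k₂) (hdisj : G.supp C1 ∩ G.supp C2 = ∅)
    (hspan : G.supp C1 ∪ G.supp C2 = Set.univ) {J₁ A₁ : Set (ZMod n₁)} {J₂ A₂ : Set (ZMod n₂)}
    (h₁ : Traversal.IsPattern k₁ J₁ A₁) (h₂ : Traversal.IsPattern k₂ J₂ A₂)
    (hJ₁ : ∀ z ∈ J₁, X.partner (T₁.c z) ∈ T₁.c '' J₁ ∪ T₂.c '' J₂)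
    (hJ₂ : ∀ z ∈ J₂, X.partner (T₂.c z) ∈ T₁.c '' J₁ ∪ T₂.c '' J₂) :
    G.IsPM (X.edge '' (T₁.c '' J₁ ∪ T₂.c '' J₂) ∪ (T₁.e '' A₁ ∪ T₂.e '' A₂)) := by
  have hd : ∀ v, v ∈ G.supp C1 → v ∉ G.supp C2 := fun v hv hv' =>
    Set.eq_empty_iff_forall_notMem.1 hdisj v ⟨hv, hv'⟩
  refine X.isPM_union ?_ ?_
  · rintro _ (⟨z, hz, rfl⟩ | ⟨z, hz, rfl⟩)
    · exact hJ₁ z hz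
    · exact hJ₂ z hz
  · intro v
    rcases hspan.symm ▸ Set.mem_univ v with hv | hv
    · obtain ⟨j, rfl⟩ := T₁.exists_c_eq hv
      have e1 : ∀ e, (e ∈ T₁.e '' A₁ ∪ T₂.e '' A₂ ∧ T₁.c j ∈ G.inc e) ↔
          (e ∈ T₁.e '' A₁ ∧ T₁.c j ∈ G.inc e) := fun e =>
        ⟨fun he => ⟨he.1.resolve_right fun h => hd _ hv ⟨e, T₂.image_e_subset _ h, he.2⟩, he.2⟩,
          fun he => ⟨.inl he.1, he.2⟩⟩
      have e2 : T₁.c j ∈ T₁.c '' J₁ ∪ T₂.c '' J₂ ↔ j ∈ J₁ := by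
        refine ⟨?_, fun h => .inl ⟨j, h, rfl⟩⟩
        rintro (⟨u, hu, huj⟩ | ⟨u, hu, huj⟩)
        · exact T₁.c_inj huj ▸ hu
        · exact absurd (huj ▸ T₂.c_mem_supp u) (hd _ hv)
      rw [e2]
      simp only [e1]
      refine (h₁.local_matching T₁ j).imp_left fun h => ⟨h.1, fun e he hje => ?_⟩
      exact h.2 e ((e1 e).1 ⟨he, hje⟩).1 hje
    · obtain ⟨j, rfl⟩ := T₂.exists_c_eq hv
      have e1 : ∀ e, (e ∈ T₁.e '' A₁ ∪ T₂.e '' A₂ ∧ T₂.c j ∈ G.inc e) ↔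
          (e ∈ T₂.e '' A₂ ∧ T₂.c j ∈ G.inc e) := fun e =>
        ⟨fun he => ⟨he.1.resolve_left fun h => hd _ ⟨e, T₁.image_e_subset _ h, he.2⟩ hv, he.2⟩,
          fun he => ⟨.inr he.1, he.2⟩⟩
      have e2 : T₂.c j ∈ T₁.c '' J₁ ∪ T₂.c '' J₂ ↔ j ∈ J₂ := by
        refine ⟨?_, fun h => .inr ⟨j, h, rfl⟩⟩
        rintro (⟨u, hu, huj⟩ | ⟨u, hu, huj⟩)
        · exact absurd hv (hd _ (huj ▸ T₁.c_mem_supp u))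
        · exact T₂.c_inj huj ▸ hu
      rw [e2]
      simp only [e1]
      refine (h₂.local_matching T₂ j).imp_left fun h => ⟨h.1, fun e he hje => ?_⟩
      exact h.2 e ((e1 e).1 ⟨he, hje⟩).1 hje

theorem val_sub_one_even_iff {n : ℕ} (hn : Even n) [NeZero n] (j : ZMod n) :
    Even (j - 1).val ↔ ¬ Even j.val := by
  have h2 : 2 ≤ n := by have := NeZero.pos n; obtain ⟨r, rfl⟩ := hn; omega
  have h1 : (1 : ZMod n).val = 1 := by
    have := ZMod.val_natCast_of_lt (n := n) (a := 1) (by omega)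
    simpa using this
  have h3 := ZMod.val_add_of_lt (a := j - 1) (b := 1)
  have h4 := ZMod.val_add_of_le (a := j - 1) (b := 1)
  rw [sub_add_cancel, h1] at h3 h4
  rcases lt_or_ge ((j - 1).val + 1) n with h | h
  · rw [h3 h, Nat.even_add_one, not_not]
  · have h5 := ZMod.val_lt (j - 1)
    have h6 := h4 h
    obtain ⟨r, rfl⟩ := hn
    rw [Nat.even_iff, Nat.even_iff]
    omega

theorem isPattern_even {n : ℕ} (hn : Even n) [NeZero n] :
    Traversal.IsPattern (1 : ZMod n) ∅ {j | Even j.val} := by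
  intro j
  have := val_sub_one_even_iff hn j
  simp only [Set.mem_empty_iff_false, Set.mem_ofPred_eq, this]
  tauto

theorem isPattern_odd {n : ℕ} (hn : Even n) [NeZero n] :
    Traversal.IsPattern (1 : ZMod n) ∅ {j | ¬ Even j.val} := by
  intro j
  have := val_sub_one_even_iff hn j
  simp only [Set.mem_empty_iff_false, Set.mem_ofPred_eq, this]
  tauto

theorem isPattern_comp {K : Type*} {h : ℕ} (S : OddSide K h) (p : ZMod (2 * h + 1)) :
    Traversal.IsPattern (h : ZMod (2 * h + 1)) (S.comp p) {u | S.Covers p u} := by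
  have hneg : ∀ u, u ≠ p → (p - u).val + (u - p).val = 2 * h + 1 := fun u hu =>
    ZMod.val_add_val_sub_comm hu.symm
  intro j
  simp only [Set.mem_ofPred_eq, OddSide.Covers]
  have hlt := ZMod.val_lt (j - p)
  rcases Nat.eq_zero_or_pos (j - p).val with h0 | h0
  · obtain rfl := val_sub_eq_zero.1 h0
    have h1 : (j - (j - (h : ZMod (2 * h + 1)))).val = h := by
      rw [sub_sub_cancel, ZMod.val_natCast_of_lt (by omega)]
    rw [h1]
    have := S.self_mem_comp j
    simp only [sub_self, ZMod.val_zero]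
    simp [this]
  · have hjp : j ≠ p := by rintro rfl; simp at h0
    have h1 := hneg j hjp
    rcases le_or_gt (j - p).val h with h2 | h2
    · have h3 : ¬ h < (p - (j - (h : ZMod (2 * h + 1)))).val := by
        rcases h2.eq_or_lt with h2 | h2
        · have : j - (h : ZMod (2 * h + 1)) = p := by
            rw [ZMod.eq_add_val_sub j p, h2]; ring
          rw [this]; simp
        · have h4 : (j - (h : ZMod (2 * h + 1)) - p).val = (j - p).val + (h + 1) := by
            rw [sub_natCast_eq, ZMod.val_sub_add _ _ _ (by omega)]
          have h5 : j - (h : ZMod (2 * h + 1)) ≠ p := by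
            intro hc; rw [hc] at h4; simp at h4
          have := hneg _ h5
          omega
      have h4 : h < (p - j).val := by omega
      tauto
    · have h3 := S.swapMap_mem_comp_iff (p := p) (z := j)
      have h4 := val_swapMap_of_lt h2
      rw [swapMap_of_lt h2] at h3 h4
      have h5 : j - (h : ZMod (2 * h + 1)) ≠ p := by
        intro hc; rw [hc] at h4; simp at h4; omega
      have := hneg _ h5
      have h6 : h < (p - (j - (h : ZMod (2 * h + 1)))).val := by omega
      have h7 : ¬ h < (p - j).val := by omega
      tauto

theorem exists_oddSide {C D : Set E} {h : ℕ} {k : ZMod (2 * h + 1)} (X : G.CoMatching D)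
    (T : G.Traversal C (2 * h + 1) k) {K : Type*} (mark : K → ZMod (2 * h + 1))
    (hinj : Function.Injective mark)
    (hmark : ∀ z, X.partner (T.c z) ∉ G.supp C ↔ ∃ k, mark k = z) :
    ∃ S : OddSide K h, S.mark = mark ∧ ∀ z w, X.partner (T.c z) = T.c w → S.mate z = w := by
  have hex : ∀ z, ∃ w, (X.partner (T.c z) = T.c w) ∨ (X.partner (T.c z) ∉ G.supp C ∧ w = z) := by
    intro z
    by_cases hz : X.partner (T.c z) ∈ G.supp C
    · obtain ⟨w, hw⟩ := T.exists_c_eq hz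
      exact ⟨w, .inl hw.symm⟩
    · exact ⟨z, .inr ⟨hz, rfl⟩⟩
  choose f hf using hex
  have hfc : ∀ z w, X.partner (T.c z) = T.c w → f z = w := by
    intro z w hzw
    rcases hf z with h1 | ⟨h1, -⟩
    · exact T.c_inj (h1.symm.trans hzw)
    · exact absurd (hzw ▸ T.c_mem_supp w) h1
  have hff : Function.Involutive f := by
    intro z
    rcases hf z with h1 | ⟨-, h1⟩
    · apply hfc
      rw [← h1, X.partner_partner]
    · rw [h1, h1]
  refine ⟨⟨hff.toPerm f, hff, mark, hinj, fun z => ?_⟩, rfl, hfc⟩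
  rw [← hmark, Function.Involutive.coe_toPerm]
  rcases hf z with h1 | ⟨h1, h2⟩
  · refine iff_of_false (fun hz => ?_) (fun hc => hc (h1 ▸ T.c_mem_supp _))
    rw [hz] at h1
    exact X.partner_ne _ h1
  · exact iff_of_true h2 h1

theorem exists_ne_crossing (hG : G.Bridgeless) (X : G.CoMatching (C1 ∪ C2))
    (hdisj : G.supp C1 ∩ G.supp C2 = ∅) (hspan : G.supp C1 ∪ G.supp C2 = Set.univ)
    (m : {v : V // v ∈ G.supp C1 ∧ X.partner v ∈ G.supp C2}) : ∃ c, c ≠ m := by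
  by_contra! hall
  have hd : ∀ v, v ∈ G.supp C1 → v ∉ G.supp C2 := fun v hv hv' =>
    Set.eq_empty_iff_forall_notMem.1 hdisj v ⟨hv, hv'⟩
  have hr : ∀ w, G.Reach (Set.univ \ {X.edge m.1}) m.1 w → w ∈ G.supp C1 := by
    intro w hw
    induction hw with
    | refl => exact m.2.1
    | @tail u w _ h2 ih =>
      obtain ⟨e, he, hinc⟩ := h2
      have hu : u ∈ G.inc e := by rw [hinc]; simp
      have hw : w ∈ G.inc e := by rw [hinc]; simp
      by_cases h1 : e ∈ C1
      · exact ⟨e, h1, hw⟩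
      · by_cases h2 : e ∈ C2
        · exact absurd ⟨e, h2, hu⟩ (hd u ih)
        · have h3 := X.eq_edge e (by simp [h1, h2]) u hu
          have h4 : w = X.partner u := by
            rw [h3, X.inc_edge] at hinc
            exact (Sym2.congr_right.1 hinc).symm
          rcases hspan.symm ▸ Set.mem_univ w with hw' | hw'
          · exact hw'
          · have h5 := congrArg Subtype.val (hall ⟨u, ih, h4 ▸ hw'⟩)
            exact absurd (h3.trans (congrArg X.edge h5)) he.2
  exact hd _ (hr _ (hG _ _ _ (X.inc_edge m.1))) m.2.2

/-- `G` has a perfect matching cover of order 5. -/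
def HasCoverFive (G : Multigraph V E) : Prop :=
  ∃ M1 M2 M3 M4 M5 : Set E, G.IsPM M1 ∧ G.IsPM M2 ∧ G.IsPM M3 ∧
    G.IsPM M4 ∧ G.IsPM M5 ∧ ∀ e : E, e ∈ M1 ∪ M2 ∪ M3 ∪ M4 ∪ M5

theorem hasCoverFive_of_even (X : G.CoMatching (C1 ∪ C2)) [NeZero n₁] [NeZero n₂]
    (T₁ : G.Traversal C1 n₁ 1) (T₂ : G.Traversal C2 n₂ 1) (h₁ : Even n₁) (h₂ : Even n₂)
    (hdisj : G.supp C1 ∩ G.supp C2 = ∅) (hspan : G.supp C1 ∪ G.supp C2 = Set.univ) :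
    G.HasCoverFive := by
  have hA := isPM_of_isPattern X T₁ T₂ hdisj hspan (isPattern_even h₁) (isPattern_even h₂)
    (by simp) (by simp)
  have hB := isPM_of_isPattern X T₁ T₂ hdisj hspan (isPattern_odd h₁) (isPattern_odd h₂)
    (by simp) (by simp)
  refine ⟨_, _, _, _, _, X.isPM_compl, hA, hB, hA, hB, fun e => ?_⟩
  by_cases he : e ∈ C1 ∪ C2
  · rcases he with he | he
    · obtain ⟨u, rfl⟩ := T₁.exists_e_eq he
      by_cases hu : Even u.val
      · exact .inl (.inl (.inl (.inr (.inr (.inl ⟨u, hu, rfl⟩)))))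
      · exact .inl (.inl (.inr (.inr (.inl ⟨u, hu, rfl⟩))))
    · obtain ⟨u, rfl⟩ := T₂.exists_e_eq he
      by_cases hu : Even u.val
      · exact .inl (.inl (.inl (.inr (.inr (.inr ⟨u, hu, rfl⟩)))))
      · exact .inl (.inl (.inr (.inr (.inr ⟨u, hu, rfl⟩))))
  · exact .inl (.inl (.inl (.inl he)))

theorem hasCoverFive_of_odd [Finite V] (hG : G.Bridgeless) (X : G.CoMatching (C1 ∪ C2))
    {h₁ h₂ : ℕ} (hh₁ : 1 ≤ h₁) (hh₂ : 1 ≤ h₂)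
    (T₁ : G.Traversal C1 (2 * h₁ + 1) h₁) (T₂ : G.Traversal C2 (2 * h₂ + 1) h₂)
    (hdisj : G.supp C1 ∩ G.supp C2 = ∅) (hspan : G.supp C1 ∪ G.supp C2 = Set.univ) :
    G.HasCoverFive := by
  have hd : ∀ v, v ∉ G.supp C1 ↔ v ∈ G.supp C2 := fun v =>
    ⟨fun hv => (hspan.symm ▸ Set.mem_univ v : v ∈ G.supp C1 ∪ G.supp C2).resolve_left hv,
      fun hv hv' => Set.eq_empty_iff_forall_notMem.1 hdisj v ⟨hv', hv⟩⟩
  let K := {v : V // v ∈ G.supp C1 ∧ X.partner v ∈ G.supp C2}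
  choose f₁ hf₁ using fun k : K => T₁.exists_c_eq k.2.1
  choose f₂ hf₂ using fun k : K => T₂.exists_c_eq k.2.2
  have inj₁ : Function.Injective f₁ := fun a b hab =>
    Subtype.ext (by rw [← hf₁, hab, hf₁])
  have inj₂ : Function.Injective f₂ := fun a b hab =>
    Subtype.ext (X.partner_injective (by rw [← hf₂, hab, hf₂]))
  obtain ⟨S₁, hS₁, hm₁⟩ := exists_oddSide X T₁ f₁ inj₁ fun z => by
    rw [hd]
    refine ⟨fun hz => ⟨⟨_, T₁.c_mem_supp z, hz⟩, T₁.c_inj (hf₁ _)⟩, ?_⟩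
    rintro ⟨k, rfl⟩
    rw [hf₁]
    exact k.2.2
  obtain ⟨S₂, hS₂, hm₂⟩ := exists_oddSide X T₂ f₂ inj₂ fun z => by
    rw [← hd, not_not]
    refine ⟨fun hz => ⟨⟨_, hz, (X.partner_partner _).symm ▸ T₂.c_mem_supp z⟩,
      T₂.c_inj ((hf₂ _).trans (X.partner_partner _))⟩, ?_⟩
    rintro ⟨k, rfl⟩
    rw [hf₂, X.partner_partner]
    exact k.2.1
  have hPM : ∀ p q, S₁.label p = S₂.label q → ∃ M, G.IsPM M ∧
      (∀ u, S₁.Covers p u → T₁.e u ∈ M) ∧ ∀ u, S₂.Covers q u → T₂.e u ∈ M := by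
    intro p q hpq
    refine ⟨_, isPM_of_isPattern X T₁ T₂ hdisj hspan (isPattern_comp S₁ p) (isPattern_comp S₂ q)
      (fun z hz => ?_) (fun z hz => ?_), fun u hu => .inr (.inl ⟨u, hu, rfl⟩),
      fun u hu => .inr (.inr ⟨u, hu, rfl⟩)⟩
    · by_cases hc : X.partner (T₁.c z) ∈ G.supp C1
      · obtain ⟨w, hw⟩ := T₁.exists_c_eq hc
        refine .inl ⟨w, ?_, hw⟩
        rw [← hm₁ z w hw.symm]
        exact S₁.mate_mem_comp hz
      · let k : K := ⟨_, T₁.c_mem_supp z, (hd _).1 hc⟩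
        have hk : S₁.mark k = z := by rw [hS₁]; exact T₁.c_inj (hf₁ k)
        refine .inr ⟨S₂.mark k, S₂.mark_mem_comp_iff.2 ?_, by rw [hS₂]; exact hf₂ k⟩
        rw [← hpq, ← S₁.mark_mem_comp_iff, hk]
        exact hz
    · by_cases hc : X.partner (T₂.c z) ∈ G.supp C1
      · let k : K := ⟨_, hc, (X.partner_partner _).symm ▸ T₂.c_mem_supp z⟩
        have hk : S₂.mark k = z := by
          rw [hS₂]; exact T₂.c_inj ((hf₂ k).trans (X.partner_partner _))
        refine .inl ⟨S₁.mark k, S₁.mark_mem_comp_iff.2 ?_, by rw [hS₁]; exact hf₁ k⟩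
        rw [hpq, ← S₂.mark_mem_comp_iff, hk]
        exact hz
      · obtain ⟨w, hw⟩ := T₂.exists_c_eq ((hd _).1 hc)
        refine .inr ⟨w, ?_, hw⟩
        rw [← hm₂ z w hw.symm]
        exact S₂.mate_mem_comp hz
  obtain ⟨a, b, c, d, ⟨p, q, r, s, hp, hq, hr, hs, hcov⟩, p', q', r', s', hp', hq', hr', hs',
    hcov'⟩ := OddSide.exists_common_cov (S₁ := S₁) (S₂ := S₂) hh₁ hh₂
      (exists_ne_crossing hG X hdisj hspan)
  obtain ⟨M1, h1, c1, d1⟩ := hPM p p' (hp.trans hp'.symm)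
  obtain ⟨M2, h2, c2, d2⟩ := hPM q q' (hq.trans hq'.symm)
  obtain ⟨M3, h3, c3, d3⟩ := hPM r r' (hr.trans hr'.symm)
  obtain ⟨M4, h4, c4, d4⟩ := hPM s s' (hs.trans hs'.symm)
  refine ⟨M1, M2, M3, M4, _, h1, h2, h3, h4, X.isPM_compl, fun e => ?_⟩
  simp only [Set.mem_union, or_assoc, Set.mem_compl_iff]
  by_cases he1 : e ∈ C1
  · obtain ⟨u, rfl⟩ := T₁.exists_e_eq he1
    exact (hcov u).imp (c1 u) fun h => h.imp (c2 u) fun h => h.imp (c3 u) fun h => .inl (c4 u h)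
  · by_cases he2 : e ∈ C2
    · obtain ⟨u, rfl⟩ := T₂.exists_e_eq he2
      exact (hcov' u).imp (d1 u) fun h => h.imp (d2 u) fun h => h.imp (d3 u) fun h => .inl (d4 u h)
    · exact .inr (.inr (.inr (.inr (by tauto))))

end Multigraph

open Multigraph in
/-- Theorem 2: a bridgeless cubic graph with a 2-factor consisting of two
circuits has a perfect matching cover of order 5. -/
theorem statement_4 {V E : Type*} [Fintype V] [Fintype E] (G : Multigraph V E)
    (hcubic : G.IsCubic) (hbridgeless : G.Bridgeless)
    (C1 C2 : Set E) (hC1 : G.IsCircuit C1) (hC2 : G.IsCircuit C2)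
    (hdisj : G.supp C1 ∩ G.supp C2 = ∅)
    (hspan : G.supp C1 ∪ G.supp C2 = Set.univ) :
    ∃ M1 M2 M3 M4 M5 : Set E, G.IsPM M1 ∧ G.IsPM M2 ∧ G.IsPM M3 ∧
      G.IsPM M4 ∧ G.IsPM M5 ∧ ∀ e : E, e ∈ M1 ∪ M2 ∪ M3 ∪ M4 ∪ M5 := by
  obtain ⟨X⟩ := hcubic.nonempty_coMatching (C := C1 ∪ C2) fun v => by
    rcases hspan.symm ▸ Set.mem_univ v with hv | hv
    · exact deg_union_eq_two hC1 hdisj hv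
    · rw [Set.union_comm]
      exact deg_union_eq_two hC2 (by rw [Set.inter_comm, hdisj]) hv
  obtain ⟨n₁, hn₁, ⟨T₁⟩⟩ := hC1.exists_traversal
  obtain ⟨n₂, hn₂, ⟨T₂⟩⟩ := hC2.exists_traversal
  have : NeZero n₁ := ⟨by omega⟩
  have : NeZero n₂ := ⟨by omega⟩
  have hcard := X.even_card
  rw [card_eq_add T₁ T₂ hdisj hspan, Nat.even_add] at hcard
  rcases Nat.even_or_odd n₁ with h | h
  · exact hasCoverFive_of_even X T₁ T₂ h (hcard.1 h) hdisj hspan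
  · obtain ⟨h₂, rfl⟩ : Odd n₂ := by
      rwa [← Nat.not_even_iff_odd, ← hcard, Nat.not_even_iff_odd]
    obtain ⟨h₁, rfl⟩ := h
    exact hasCoverFive_of_odd hbridgeless X (by omega) (by omega) T₁.double T₂.double hdisj hspan
end

section
/- Let G be a bridgeless cubic graph with a 2-factor consisting of two odd circuits C1 and C2, let u1u2 be an edge of G with u1 ∈ V(C1) and u2 ∈ V(C2), let M3 = E(G) \ (E(C1) ∪ E(C2)), let M2 be the perfect matching of G with M2 ∩ M3 = {u1u2}, and let M1 = (E(C1) ∪ E(C2)) \ M2. For i = 1, 2, let C_{i+2} be the circuit containing u_i in the subgraph of G induced by the edge set E(G) \ M2. Suppose C3 ≠ C4, E(C3) ∩ E(C2) = ∅, and E(C1) ∩ E(C4) = ∅. Let C5 be a circuit in the subgraph of G induced by E(G) \ M2 such that E(C5) ∩ E(C1) ≠ ∅ and E(C5) ∩ E(C2) ≠ ∅, and let Q be the inclusionwise maximal path containing u1 in C1 such that E(Q) ∩ E(C5) = ∅. Then G has a perfect matching containing the edge set (M1 ∩ E(C1)) \ (E(Q) ∪ E(C5)). -/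
namespace Multigraph

variable {V E : Type*} {G : Multigraph V E}

/-- The sequences `f` of vertices and `e` of edges traverse the circuit `C` of length `n`
exactly once and then return to the start. -/
structure Traverses (G : Multigraph V E) (C : Set E) (f : ℕ → V) (e : ℕ → E) (n : ℕ) :
    Prop where
  inc_eq : ∀ i, G.inc (e i) = s(f i, f (i + 1))
  mem : ∀ i, e i ∈ C
  ne_succ : ∀ i, e i ≠ e (i + 1)
  closed : f n = f 0
  vertex_inj : ∀ i j, i ≤ n → j ≤ n → f i = f j →
    i = j ∨ (i = 0 ∧ j = n) ∨ (i = n ∧ j = 0)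
  edge_inj : ∀ i j, i < n → j < n → e i = e j → i = j
  exists_edge : ∀ c ∈ C, ∃ i < n, c = e i
  exists_vertex : ∀ v ∈ G.supp C, ∃ i < n, v = f i
  length_eq : n = C.ncard

theorem ne_of_inc_eq {a : E} {v w : V} (h : G.inc a = s(v, w)) : v ≠ w := by
  intro hvw
  exact G.no_loops a (by rw [h, hvw]; exact Sym2.mk_isDiag_iff.2 rfl)

theorem Reach.mono {F F' : Set E} (h : F ⊆ F') {u v : V} (huv : G.Reach F u v) :
    G.Reach F' u v :=
  Relation.ReflTransGen.mono (fun _ _ ⟨c, hc, hi⟩ => ⟨c, h hc, hi⟩) _ _ huv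

theorem eq_or_eq_of_deg_eq_two {C : Set E} {v : V} (hdeg : G.deg C v = 2) {a b c : E}
    (ha : a ∈ C) (hav : v ∈ G.inc a) (hb : b ∈ C) (hbv : v ∈ G.inc b) (hab : a ≠ b)
    (hc : c ∈ C) (hcv : v ∈ G.inc c) : c = a ∨ c = b := by
  obtain ⟨x, y, -, hxy⟩ := Set.ncard_eq_two.1 hdeg
  have h : ∀ d, d ∈ C → v ∈ G.inc d → d = x ∨ d = y := fun d hd hdv => by
    have : d ∈ ({x, y} : Set E) := hxy ▸ ⟨hd, hdv⟩
    simpa using this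
  have h1 := h a ha hav
  have h2 := h b hb hbv
  have h3 := h c hc hcv
  grind

theorem exists_ne_of_deg_eq_two {C : Set E} {v : V} (hdeg : G.deg C v = 2) (a : E) :
    ∃ b ∈ C, v ∈ G.inc b ∧ b ≠ a := by
  obtain ⟨x, y, hne, hxy⟩ := Set.ncard_eq_two.1 hdeg
  have hx : x ∈ {e ∈ C | v ∈ G.inc e} := by simp [hxy]
  have hy : y ∈ {e ∈ C | v ∈ G.inc e} := by simp [hxy]
  by_cases h : x = a
  · exact ⟨y, hy.1, hy.2, fun h' => hne (h.trans h'.symm)⟩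
  · exact ⟨x, hx.1, hx.2, h⟩

theorem supp_subset_of_closed {C : Set E} (hC : G.IsCircuit C) {v : V} (hv : v ∈ G.supp C)
    {S : Set V} (hvS : v ∈ S)
    (hS : ∀ x ∈ S, ∀ y, ∀ c ∈ C, G.inc c = s(x, y) → y ∈ S) : G.supp C ⊆ S := by
  intro w hw
  induction hC.2.2 v hv w hw with
  | refl => exact hvS
  | tail _ h ih =>
    obtain ⟨c, hc, hi⟩ := h
    exact hS _ (ih ⟨c, hc, by simp [hi]⟩) _ c hc hi

/-- A closed-up nonbacktracking walk in a circuit sees each vertex in only one direction. -/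
theorem edge_eq_of_vertex_eq {C : Set E} (hC : G.IsCircuit C) {f : ℕ → V} {e : ℕ → E}
    (hinc : ∀ i, G.inc (e i) = s(f i, f (i + 1))) (hmem : ∀ i, e i ∈ C)
    (hne : ∀ i, e i ≠ e (i + 1)) (d : ℕ) :
    ∀ i, f i = f (i + d) → e i = e (i + d) := by
  induction d using Nat.strong_induction_on with
  | _ d ih =>
    intro i hf
    by_contra hcon
    rcases d with _ | _ | d
    · simp at hcon
    · exact ne_of_inc_eq (hinc i) hf
    · have hj := hinc (i + (d + 1))
      have hj' := hinc (i + (d + 1) + 1)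
      have hi := hinc i
      have hdeg := hC.2.1 (f i) ⟨e i, hmem i, by simp [hi]⟩
      have key : e i = e (i + (d + 1)) := by
        rcases eq_or_eq_of_deg_eq_two hdeg (hmem (i + (d + 1))) (by rw [hj, hf]; simp [add_assoc])
          (hmem (i + (d + 1) + 1)) (by rw [hj', hf]; simp [add_assoc]) (hne _) (hmem i)
          (by simp [hi]) with h | h
        · exact h
        · exact absurd h hcon
      have hv : f (i + 1) = f (i + 1 + d) := by
        rw [key, hj] at hi
        rw [show i + (d + 1) + 1 = i + (d + 1 + 1) by ring, ← hf] at hi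
        rw [show i + 1 + d = i + (d + 1) by ring]
        have hne' := ne_of_inc_eq (hinc i)
        rw [Sym2.eq_iff] at hi
        grind
      have := ih d (by omega) (i + 1) hv
      rw [show i + 1 + d = i + (d + 1) by ring, ← key] at this
      exact hne i this.symm

theorem IsCircuit.exists_traverses [Finite V] [Finite E] {C : Set E} (hC : G.IsCircuit C)
    {v : V} {a : E} (ha : a ∈ C) (hva : v ∈ G.inc a) :
    ∃ (f : ℕ → V) (e : ℕ → E) (n : ℕ), G.Traverses C f e n ∧ f 0 = v ∧ e 0 = a := by
  let D := {p : V × E // p.2 ∈ C ∧ p.1 ∈ G.inc p.2}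
  have hstep : ∀ d : D, ∃ d' : D,
      G.inc d.1.2 = s(d.1.1, d'.1.1) ∧ d.1.2 ≠ d'.1.2 := by
    rintro ⟨⟨x, c⟩, hc, y, hy⟩
    obtain ⟨b, hb, hyb, hbc⟩ :=
      exists_ne_of_deg_eq_two (hC.2.1 y ⟨c, hc, by simp only [hy]; simp⟩) c
    exact ⟨⟨(y, b), hb, hyb⟩, hy, hbc.symm⟩
  choose T hTinc hTne using hstep
  have hTinj : Function.Injective T := by
    intro d d' h
    have h1 := hTinc d
    have h2 := hTinc d'
    have h3 := hTne d
    have h4 := hTne d'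
    rw [← h] at h2 h4
    have hw := (T d).2
    have hedge : d.1.2 = d'.1.2 := by
      rcases eq_or_eq_of_deg_eq_two (hC.2.1 _ ⟨_, hw.1, hw.2⟩) d.2.1 (by rw [h1]; simp)
        hw.1 hw.2 h3 d'.2.1 (by rw [h2]; simp) with h5 | h5
      · exact h5.symm
      · exact absurd h5 h4
    have hvert : d.1.1 = d'.1.1 := by
      rw [hedge, h2] at h1
      exact (Sym2.congr_left.1 h1).symm
    exact Subtype.ext (Prod.ext hvert hedge)
  let d0 : D := ⟨(v, a), ha, hva⟩
  let f : ℕ → V := fun i => (T^[i] d0).1.1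
  let e : ℕ → E := fun i => (T^[i] d0).1.2
  let n := Function.minimalPeriod T d0
  have hn : 0 < n := Function.minimalPeriod_pos_of_mem_periodicPts
    (hTinj.mem_periodicPts d0)
  have hper : T^[n] d0 = d0 := Function.isPeriodicPt_minimalPeriod T d0
  have hinj : ∀ i j, i < n → j < n → T^[i] d0 = T^[j] d0 → i = j := fun i j hi hj h =>
    Function.iterate_injOn_Iio_minimalPeriod hi hj h
  have hinc : ∀ i, G.inc (e i) = s(f i, f (i + 1)) := fun i => by
    simp only [f, e, Function.iterate_succ_apply']
    exact hTinc _
  have hmem : ∀ i, e i ∈ C := fun i => (T^[i] d0).2.1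
  have hne : ∀ i, e i ≠ e (i + 1) := fun i => by
    simp only [e, Function.iterate_succ_apply']
    exact hTne _
  have hfe : ∀ i j, f i = f j → e i = e j := by
    intro i j h
    rcases le_total i j with hij | hij
    · obtain ⟨d, rfl⟩ := Nat.exists_eq_add_of_le hij
      exact edge_eq_of_vertex_eq hC hinc hmem hne d i h
    · obtain ⟨d, rfl⟩ := Nat.exists_eq_add_of_le hij
      exact (edge_eq_of_vertex_eq hC hinc hmem hne d j h.symm).symm
  have hdart : ∀ i j, f i = f j → T^[i] d0 = T^[j] d0 := fun i j h =>
    Subtype.ext (Prod.ext h (hfe i j h))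
  have hef : ∀ i j, e i = e j → f i = f j := by
    intro i j h
    have hi := hinc i
    rw [h, hinc j, Sym2.eq_iff] at hi
    rcases hi with h1 | h1
    · exact h1.1.symm
    · exact absurd (h ▸ hfe _ _ h1.2.symm) (hne j)
  have hfn : f n = f 0 := by simp [f, hper]
  have hmod : ∀ i, T^[i % n] d0 = T^[i] d0 := fun i =>
    Function.iterate_mod_minimalPeriod_eq
  have hfinj : ∀ i j, i < n → j < n → f i = f j → i = j := fun i j hi hj h =>
    hinj i j hi hj (hdart i j h)
  have hclosed : ∀ i, ∀ c ∈ C, f i ∈ G.inc c → ∃ k, c = e k := by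
    intro i c hc hic
    have h1 : f (i + n) = f i := by
      simp only [f, Function.iterate_add_apply, hper]
    obtain ⟨m, hm⟩ : ∃ m, i + n = m + 1 := ⟨i + n - 1, by omega⟩
    rw [← h1, hm] at hic
    rcases eq_or_eq_of_deg_eq_two (hC.2.1 _ ⟨c, hc, hic⟩) (hmem m) (by simp [hinc])
      (hmem (m + 1)) (by simp [hinc]) (hne m) hc hic with h | h
    exacts [⟨_, h⟩, ⟨_, h⟩]
  have hsupp : G.supp C ⊆ Set.range f := by
    refine supp_subset_of_closed hC ⟨a, ha, hva⟩ ⟨0, rfl⟩ ?_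
    rintro _ ⟨i, rfl⟩ y c hc hi
    obtain ⟨k, rfl⟩ := hclosed i c hc (by simp [hi])
    have : y ∈ G.inc (e k) := by simp [hi]
    rw [hinc k] at this
    rcases Sym2.mem_iff.1 this with h | h
    exacts [⟨_, h.symm⟩, ⟨_, h.symm⟩]
  have hesurj : ∀ c ∈ C, ∃ i < n, c = e i := by
    intro c hc
    induction hcc : G.inc c with
    | _ x y =>
      obtain ⟨i, hi⟩ := hsupp ⟨c, hc, by rw [hcc]; exact Sym2.mem_mk_left x y⟩
      obtain ⟨k, rfl⟩ := hclosed i c hc (by rw [hi, hcc]; simp)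
      exact ⟨k % n, Nat.mod_lt _ hn, by simp only [e, hmod]⟩
  have heinj : ∀ i j, i < n → j < n → e i = e j → i = j := fun i j hi hj h =>
    hfinj i j hi hj (hef i j h)
  refine ⟨f, e, n, ⟨hinc, hmem, hne, hfn, ?_, heinj, hesurj, ?_, ?_⟩, rfl, rfl⟩
  · intro i j hi hj h
    rcases hi.lt_or_eq with hi | rfl <;> rcases hj.lt_or_eq with hj | rfl
    · exact Or.inl (hfinj i j hi hj h)
    · exact Or.inr (Or.inl ⟨hfinj i 0 hi hn (h.trans hfn), rfl⟩)
    · exact Or.inr (Or.inr ⟨rfl, (hfinj 0 j hn hj (hfn.symm.trans h)).symm⟩)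
    · exact Or.inl rfl
  · intro w hw
    obtain ⟨i, rfl⟩ := hsupp hw
    exact ⟨i % n, Nat.mod_lt _ hn, by simp only [f, hmod]⟩
  · have : C = e '' Set.Iio n := by
      ext c
      constructor
      · intro hc
        obtain ⟨i, hi, rfl⟩ := hesurj c hc
        exact ⟨i, hi, rfl⟩
      · rintro ⟨i, -, rfl⟩
        exact hmem i
    have hon : Set.InjOn e (Set.Iio n) := fun i hi j hj h => heinj i j hi hj h
    rw [this, hon.ncard_image, ← Finset.coe_Iio, Set.ncard_coe_finset, Nat.card_Iio]

theorem Traverses.mem_inc {C : Set E} {f : ℕ → V} {e : ℕ → E} {n : ℕ}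
    (h : G.Traverses C f e n) {v : V} {i : ℕ} : v ∈ G.inc (e i) ↔ v = f i ∨ v = f (i + 1) := by
  rw [h.inc_eq, Sym2.mem_iff]

theorem Traverses.pos {C : Set E} {f : ℕ → V} {e : ℕ → E} {n : ℕ}
    (h : G.Traverses C f e n) : 0 < n := by
  obtain ⟨i, hi, -⟩ := h.exists_edge _ (h.mem 0)
  omega

theorem Traverses.vertex_mem_supp {C : Set E} {f : ℕ → V} {e : ℕ → E} {n : ℕ}
    (h : G.Traverses C f e n) (i : ℕ) : f i ∈ G.supp C :=
  ⟨e i, h.mem i, h.mem_inc.2 (Or.inl rfl)⟩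

/-- The odd edges before position `p` together with the even edges after it. -/
def shiftedMatching (e : ℕ → E) (n p : ℕ) : Set E :=
  {b | ∃ i, (i < p ∧ i % 2 = 1 ∨ p < i ∧ i < n ∧ i % 2 = 0) ∧ b = e i}

theorem Traverses.shiftedMatching_subset {C : Set E} {f : ℕ → V} {e : ℕ → E} {n p : ℕ}
    (h : G.Traverses C f e n) : shiftedMatching e n p ⊆ C := by
  rintro _ ⟨i, -, rfl⟩
  exact h.mem i

theorem Traverses.notMem_inc_of_mem_shiftedMatching {C : Set E} {f : ℕ → V} {e : ℕ → E}
    {n p : ℕ} (h : G.Traverses C f e n) (hp : p % 2 = 0) (hpn : p < n) {b : E}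
    (hb : b ∈ shiftedMatching e n p) : f (p + 1) ∉ G.inc b := by
  obtain ⟨i, hi, rfl⟩ := hb
  intro hv
  rcases h.mem_inc.1 hv with hv | hv
  · have := h.vertex_inj (p + 1) i (by omega) (by omega) hv
    omega
  · have := h.vertex_inj (p + 1) (i + 1) (by omega) (by omega) hv
    omega

theorem Traverses.existsUnique_mem_shiftedMatching {C : Set E} {f : ℕ → V} {e : ℕ → E}
    {n p : ℕ} (h : G.Traverses C f e n) (hn : n % 2 = 1) (hp : p % 2 = 0) (hpn : p < n)
    {v : V} (hv : v ∈ G.supp C) (hvp : v ≠ f (p + 1)) :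
    ∃! b, b ∈ shiftedMatching e n p ∧ v ∈ G.inc b := by
  obtain ⟨m, hm0, hmn, rfl⟩ : ∃ m, 0 < m ∧ m ≤ n ∧ v = f m := by
    obtain ⟨i, hi, rfl⟩ := h.exists_vertex v hv
    rcases Nat.eq_zero_or_pos i with rfl | h0
    · exact ⟨n, h.pos, le_rfl, h.closed.symm⟩
    · exact ⟨i, h0, hi.le, rfl⟩
  have hmp : m ≠ p + 1 := fun h' => hvp (by rw [h'])
  obtain ⟨k, hk, hkm⟩ : ∃ k, (k < p ∧ k % 2 = 1 ∨ p < k ∧ k < n ∧ k % 2 = 0) ∧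
      (m = k ∨ m = k + 1) := by
    by_cases hlt : m < p + 1 <;> rcases Nat.mod_two_eq_zero_or_one m with h2 | h2
    · exact ⟨m - 1, by omega, by omega⟩
    · exact ⟨m, by omega, by omega⟩
    · exact ⟨m, by omega, by omega⟩
    · exact ⟨m - 1, by omega, by omega⟩
  refine ⟨e k, ⟨⟨k, hk, rfl⟩, h.mem_inc.2 (by rcases hkm with rfl | rfl <;> simp)⟩, ?_⟩
  rintro _ ⟨⟨i, hi, rfl⟩, hb⟩
  congr 1
  rcases h.mem_inc.1 hb with hb | hb
  · have := h.vertex_inj m i (by omega) (by omega) hb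
    omega
  · have := h.vertex_inj m (i + 1) (by omega) (by omega) hb
    omega

/-- An odd circuit has a matching covering all of its vertices but a prescribed one. -/
theorem IsCircuit.exists_near_perfect [Finite V] [Finite E] {C : Set E} (hC : G.IsCircuit C)
    (hodd : Odd C.ncard) {z : V} (hz : z ∈ G.supp C) :
    ∃ N ⊆ C, (∀ b ∈ N, z ∉ G.inc b) ∧
      ∀ v ∈ G.supp C, v ≠ z → ∃! b, b ∈ N ∧ v ∈ G.inc b := by
  obtain ⟨a, ha, hza⟩ := hz
  obtain ⟨f, e, n, h, rfl, -⟩ := hC.exists_traverses ha hza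
  rw [← h.length_eq, Nat.odd_iff] at hodd
  have hlast : f (n - 1 + 1) = f 0 := by rw [Nat.sub_add_cancel h.pos, h.closed]
  refine ⟨shiftedMatching e n (n - 1), h.shiftedMatching_subset, fun b hb => ?_,
    fun v hv hvz => ?_⟩
  · rw [← hlast]
    exact h.notMem_inc_of_mem_shiftedMatching (by omega) (by omega) hb
  · rw [← hlast] at hvz
    exact h.existsUnique_mem_shiftedMatching hodd (by omega) (by omega) hv hvz

/-- Exchanging a near-perfect matching of one side of a cut along an alternating path that
crosses the cut, and completing it by a near-perfect matching of the other side. -/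
theorem Traverses.isPM_exchange {C : Set E} {g : ℕ → V} {h : ℕ → E} {n : ℕ}
    (hT : G.Traverses C g h n) {S : Set V} {N N' : Set E} {j : ℕ}
    (hNS : ∀ b ∈ N, ∀ v ∈ G.inc b, v ∈ S) (hN1 : ∀ b ∈ N, g 1 ∉ G.inc b)
    (hN : ∀ v ∈ S, v ≠ g 1 → ∃! b, b ∈ N ∧ v ∈ G.inc b)
    (hNS' : ∀ b ∈ N', ∀ v ∈ G.inc b, v ∉ S) (hN1' : ∀ b ∈ N', g j ∉ G.inc b)
    (hN' : ∀ v ∉ S, v ≠ g j → ∃! b, b ∈ N' ∧ v ∈ G.inc b)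
    (hj0 : 0 < j) (hj2 : j % 2 = 0) (hjn : j < n)
    (hgS : ∀ i < j, g i ∈ S) (hgj : g j ∉ S)
    (hmem : ∀ i, 0 < i → i < j → i % 2 = 0 → h i ∈ N) :
    G.IsPM ((N \ {b | ∃ i < j, i % 2 = 0 ∧ b = h i}) ∪
      {b | ∃ i < j, i % 2 = 1 ∧ b = h i} ∪ N') := by
  refine ⟨Set.subset_univ _, fun _ _ _ _ => trivial, fun v _ => ?_⟩
  have hpath : ∀ i, 0 < i → i ≤ j → g i ∈ G.inc (h (if i % 2 = 1 then i else i - 1)) := by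
    intro i hi hij
    rw [hT.mem_inc]
    split_ifs
    · exact Or.inl rfl
    · exact Or.inr (by rw [Nat.sub_add_cancel hi])
  have hpath' : ∀ i l, 0 < i → i ≤ j → l < j → l % 2 = 1 → g i ∈ G.inc (h l) →
      l = if i % 2 = 1 then i else i - 1 := by
    intro i l hi hij hl hl2 hil
    rcases hT.mem_inc.1 hil with hil | hil
    · have := hT.vertex_inj i l (by omega) (by omega) hil
      split_ifs <;> omega
    · have := hT.vertex_inj i (l + 1) (by omega) (by omega) hil
      split_ifs <;> omega
  by_cases hvS : v ∈ S
  · by_cases hvg : ∃ i, 0 < i ∧ i < j ∧ v = g i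
    · obtain ⟨i, hi, hij, rfl⟩ := hvg
      refine ⟨h (if i % 2 = 1 then i else i - 1),
        ⟨Or.inl (Or.inr ⟨_, ?_, ?_, rfl⟩), hpath i hi hij.le⟩, ?_⟩
      · split_ifs <;> omega
      · split_ifs <;> omega
      rintro b ⟨(⟨hbN, hbh⟩ | ⟨l, hl, hl2, rfl⟩) | hb, hib⟩
      · exfalso
        rcases eq_or_ne i 1 with rfl | hi1
        · exact hN1 b hbN hib
        have hg1 : g i ≠ g 1 := fun heq => by
          have := hT.vertex_inj i 1 (by omega) (by omega) heq
          omega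
        obtain ⟨c, -, hc⟩ := hN (g i) hvS hg1
        have hm : ∃ m, 0 < m ∧ m < j ∧ m % 2 = 0 ∧ g i ∈ G.inc (h m) := by
          rcases Nat.mod_two_eq_zero_or_one i with h2 | h2
          · exact ⟨i, hi, hij, h2, hT.mem_inc.2 (Or.inl rfl)⟩
          · refine ⟨i - 1, by omega, by omega, by omega, hT.mem_inc.2 (Or.inr ?_)⟩
            rw [Nat.sub_add_cancel hi]
        obtain ⟨m, hm0, hmj, hm2, him⟩ := hm
        exact hbh ⟨m, hmj, hm2,
          (hc b ⟨hbN, hib⟩).trans (hc (h m) ⟨hmem m hm0 hmj hm2, him⟩).symm⟩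
      · rw [← hpath' i l hi hij.le hl hl2 hib]
      · exact absurd hvS (hNS' b hb _ hib)
    · have hv1 : v ≠ g 1 := fun heq => hvg ⟨1, by omega, by omega, heq⟩
      obtain ⟨c, ⟨hcN, hvc⟩, hc⟩ := hN v hvS hv1
      refine ⟨c, ⟨Or.inl (Or.inl ⟨hcN, ?_⟩), hvc⟩, ?_⟩
      · rintro ⟨m, hm, hm2, rfl⟩
        rcases Nat.eq_zero_or_pos m with rfl | hm0
        · exact hN1 _ hcN (hT.mem_inc.2 (Or.inr rfl))
        · rcases hT.mem_inc.1 hvc with rfl | rfl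
          · exact hvg ⟨m, hm0, hm, rfl⟩
          · exact hvg ⟨m + 1, by omega, by omega, rfl⟩
      · rintro b ⟨(⟨hbN, -⟩ | ⟨l, hl, hl2, rfl⟩) | hb, hib⟩
        · exact hc b ⟨hbN, hib⟩
        · exfalso
          rcases hT.mem_inc.1 hib with rfl | rfl
          · exact hvg ⟨l, by omega, hl, rfl⟩
          · rcases (Nat.succ_le_of_lt hl).lt_or_eq with hl' | hl'
            · exact hvg ⟨l + 1, by omega, hl', rfl⟩
            · exact hgj (hl' ▸ hvS)
        · exact absurd hvS (hNS' b hb _ hib)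
  · by_cases hvj : v = g j
    · subst hvj
      refine ⟨h (j - 1), ⟨Or.inl (Or.inr ⟨j - 1, by omega, by omega, rfl⟩),
        by simpa [hj2] using hpath j hj0 le_rfl⟩, ?_⟩
      rintro b ⟨(⟨hbN, -⟩ | ⟨l, hl, hl2, rfl⟩) | hb, hib⟩
      · exact absurd (hNS b hbN _ hib) hgj
      · have := hpath' j l hj0 le_rfl hl hl2 hib
        simp only [hj2, zero_ne_one, if_false] at this
        rw [this]
      · exact absurd hib (hN1' b hb)
    · obtain ⟨c, ⟨hcN, hvc⟩, hc⟩ := hN' v hvS hvj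
      refine ⟨c, ⟨Or.inr hcN, hvc⟩, ?_⟩
      rintro b ⟨(⟨hbN, -⟩ | ⟨l, hl, hl2, rfl⟩) | hb, hib⟩
      · exact absurd (hNS b hbN _ hib) hvS
      · exfalso
        rcases hT.mem_inc.1 hib with rfl | rfl
        · exact hvS (hgS l hl)
        · rcases (Nat.succ_le_of_lt hl).lt_or_eq with hl' | hl'
          · exact hvS (hgS _ hl')
          · exact hvj (by rw [← hl'])
      · exact hc b ⟨hb, hib⟩

/-- In a cubic graph, a circuit avoiding a perfect matching contains all edges outside the
matching at each of its vertices. -/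
theorem mem_circuit_of_notMem_perfectMatching [Finite E] (hcubic : G.IsCubic) {M C : Set E}
    (hM : G.IsPM M) (hC : G.IsCircuit C) (hCM : C ⊆ Set.univ \ M) {v : V}
    (hv : v ∈ G.supp C) {b : E} (hb : b ∉ M) (hvb : v ∈ G.inc b) : b ∈ C := by
  by_contra hbC
  obtain ⟨m, ⟨hm, hvm⟩, -⟩ := hM.2.2 v (Set.mem_univ v)
  have hmC : m ∉ C := fun h => (hCM h).2 hm
  have hsub : insert m (insert b {e ∈ C | v ∈ G.inc e}) ⊆ {e ∈ Set.univ | v ∈ G.inc e} := by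
    rintro c (rfl | rfl | hc)
    exacts [⟨trivial, hvm⟩, ⟨trivial, hvb⟩, ⟨trivial, hc.2⟩]
  have h1 := Set.ncard_le_ncard hsub
  have hmb : m ≠ b := fun h => hb (h ▸ hm)
  rw [Set.ncard_insert_of_notMem (by simp [hmb, hmC]),
    Set.ncard_insert_of_notMem (by simp [hbC])] at h1
  have h2 := hC.2.1 v hv
  have h3 := hcubic v
  unfold deg at h2 h3
  omega

/-- Two circuits avoiding a perfect matching of a cubic graph are disjoint, or the second
is contained in the first. -/
theorem circuit_subset_of_common_vertex [Finite E] (hcubic : G.IsCubic) {M C C' : Set E}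
    (hM : G.IsPM M) (hC : G.IsCircuit C) (hCM : C ⊆ Set.univ \ M)
    (hC' : G.IsCircuit C') (hCM' : C' ⊆ Set.univ \ M) {v : V}
    (hv : v ∈ G.supp C) (hv' : v ∈ G.supp C') : C' ⊆ C := by
  have hmem : ∀ x ∈ G.supp C, ∀ c ∈ C', x ∈ G.inc c → c ∈ C := fun x hx c hc hxc =>
    mem_circuit_of_notMem_perfectMatching hcubic hM hC hCM hx (hCM' hc).2 hxc
  have hsupp : G.supp C' ⊆ G.supp C := by
    refine supp_subset_of_closed hC' hv' hv fun x hx y c hc hi => ?_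
    exact ⟨c, hmem x hx c hc (by simp [hi]), by simp [hi]⟩
  intro c hc
  induction hcc : G.inc c with
  | _ x y =>
    have hx : x ∈ G.inc c := by rw [hcc]; exact Sym2.mem_mk_left x y
    exact hmem x (hsupp ⟨c, hc, hx⟩) c hc hx

end Multigraph

open Multigraph in
/-- Claim 1 in the proof of Theorem 2. -/
theorem statement_5 {V E : Type*} [Fintype V] [Fintype E] (G : Multigraph V E)
    (hcubic : G.IsCubic) (hbridgeless : G.Bridgeless)
    (C1 C2 : Set E) (hC1 : G.IsCircuit C1) (hC2 : G.IsCircuit C2)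
    (hodd1 : Odd C1.ncard) (hodd2 : Odd C2.ncard)
    (hdisj : G.supp C1 ∩ G.supp C2 = ∅)
    (hspan : G.supp C1 ∪ G.supp C2 = Set.univ)
    (u1 u2 : V) (e12 : E) (hinc : G.inc e12 = s(u1, u2))
    (hu1 : u1 ∈ G.supp C1) (hu2 : u2 ∈ G.supp C2)
    (M3 : Set E) (hM3 : M3 = Set.univ \ (C1 ∪ C2))
    (M2 : Set E) (hM2 : G.IsPM M2) (hM2cap : M2 ∩ M3 = {e12})
    (M1 : Set E) (hM1 : M1 = (C1 ∪ C2) \ M2)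
    (C3 C4 : Set E)
    (hC3 : G.IsCircuit C3) (hC3sub : C3 ⊆ Set.univ \ M2) (hu1C3 : u1 ∈ G.supp C3)
    (hC4 : G.IsCircuit C4) (hC4sub : C4 ⊆ Set.univ \ M2) (hu2C4 : u2 ∈ G.supp C4)
    (hne : C3 ≠ C4) (hC3C2 : C3 ∩ C2 = ∅) (hC1C4 : C1 ∩ C4 = ∅)
    (C5 : Set E) (hC5 : G.IsCircuit C5) (hC5sub : C5 ⊆ Set.univ \ M2)
    (hC5a : (C5 ∩ C1).Nonempty) (hC5b : (C5 ∩ C2).Nonempty)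
    -- `Q` is the inclusionwise maximal path containing `u1` in `C1` with
    -- `E(Q) ∩ E(C5) = ∅`
    (Q : Set E) (hQsub : Q ⊆ C1) (hQC5 : Q ∩ C5 = ∅)
    (hQconn : ∀ w ∈ G.supp Q, G.Reach Q u1 w)
    (hQmax : ∀ Q' : Set E, Q' ⊆ C1 → Q' ∩ C5 = ∅ →
      (∀ w ∈ G.supp Q', G.Reach Q' u1 w) → Q ⊆ Q' → Q' = Q) :
    ∃ M : Set E, G.IsPM M ∧ (M1 ∩ C1) \ (Q ∪ C5) ⊆ M := by
  classical
  subst hM3 hM1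
  have hdis : ∀ v, v ∈ G.supp C1 → v ∉ G.supp C2 := fun v h1 h2 => by
    have : v ∈ G.supp C1 ∩ G.supp C2 := ⟨h1, h2⟩
    simp [hdisj] at this
  have hcov : ∀ v, v ∉ G.supp C1 → v ∈ G.supp C2 := fun v h1 => by
    have : v ∈ G.supp C1 ∪ G.supp C2 := by simp [hspan]
    exact this.resolve_left h1
  have huniq : ∀ v a b, a ∈ M2 → b ∈ M2 → v ∈ G.inc a → v ∈ G.inc b → a = b :=
    fun v a b ha hb hva hvb =>
      (hM2.2.2 v trivial).unique ⟨ha, hva⟩ ⟨hb, hvb⟩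
  have he12 : e12 ∈ M2 ∧ e12 ∉ C1 ∪ C2 := by
    have : e12 ∈ M2 ∩ (Set.univ \ (C1 ∪ C2)) := by simp [hM2cap]
    exact ⟨this.1, this.2.2⟩
  have hM2C : ∀ b ∈ M2, b ≠ e12 → b ∈ C1 ∪ C2 := fun b hb hne' => by
    by_contra hcon
    have : b ∈ M2 ∩ (Set.univ \ (C1 ∪ C2)) := ⟨hb, trivial, hcon⟩
    rw [hM2cap] at this
    exact hne' this
  have hu1C5 : u1 ∉ G.supp C5 := fun h => by
    obtain ⟨b, hb5, hb2⟩ := hC5b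
    have : b ∈ C3 ∩ C2 :=
      ⟨circuit_subset_of_common_vertex hcubic hM2 hC3 hC3sub hC5 hC5sub hu1C3 h hb5, hb2⟩
    simp [hC3C2] at this
  have hu2C5 : u2 ∉ G.supp C5 := fun h => by
    obtain ⟨b, hb5, hb1⟩ := hC5a
    have : b ∈ C1 ∩ C4 :=
      ⟨hb1, circuit_subset_of_common_vertex hcubic hM2 hC4 hC4sub hC5 hC5sub hu2C4 h hb5⟩
    simp [hC1C4] at this
  -- Traverse `C1` from `u1`; the odd edges are exactly those in `M2`.
  obtain ⟨a0, ha0, hua0⟩ := id hu1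
  obtain ⟨f, e, n, hT, hf0, -⟩ := hC1.exists_traverses ha0 hua0
  have hn : n % 2 = 1 := by rwa [hT.length_eq, ← Nat.odd_iff]
  have halt : ∀ i < n, (e i ∈ M2 ↔ i % 2 = 1) := by
    intro i
    induction i with
    | zero =>
      intro _
      simp only [Nat.zero_mod, zero_ne_one, iff_false]
      intro h
      have := huniq u1 _ _ h he12.1 (hT.mem_inc.2 (Or.inl hf0.symm)) (by simp [hinc])
      exact he12.2 (this ▸ Or.inl (hT.mem 0))
    | succ i ih =>
      intro hi
      have ih := ih (by omega)
      have hboth : ¬ (e i ∈ M2 ∧ e (i + 1) ∈ M2) := fun h =>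
        hT.ne_succ i (huniq (f (i + 1)) _ _ h.1 h.2 (hT.mem_inc.2 (Or.inr rfl))
          (hT.mem_inc.2 (Or.inl rfl)))
      have hone : e i ∈ M2 ∨ e (i + 1) ∈ M2 := by
        obtain ⟨b, ⟨hb, hvb⟩, -⟩ := hM2.2.2 (f (i + 1)) trivial
        have hbne : b ≠ e12 := by
          rintro rfl
          rw [hinc, Sym2.mem_iff] at hvb
          rcases hvb with h | h
          · have := hT.vertex_inj (i + 1) 0 (by omega) (by omega) (h.trans hf0.symm)
            omega
          · exact hdis _ (hT.vertex_mem_supp (i + 1)) (h ▸ hu2)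
        have hb1 : b ∈ C1 := (hM2C b hb hbne).resolve_right fun h =>
          hdis _ (hT.vertex_mem_supp (i + 1)) ⟨b, h, hvb⟩
        rcases eq_or_eq_of_deg_eq_two (hC1.2.1 _ (hT.vertex_mem_supp (i + 1))) (hT.mem i)
          (hT.mem_inc.2 (Or.inr rfl)) (hT.mem (i + 1)) (hT.mem_inc.2 (Or.inl rfl))
          (hT.ne_succ i) hb1 hvb with rfl | rfl
        exacts [Or.inl hb, Or.inr hb]
      have : e (i + 1) ∈ M2 ↔ ¬ e i ∈ M2 := by tauto
      rw [this, ih]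
      omega
  -- The first edge of `C5` met along `C1`.
  have hex : ∃ i, i < n ∧ e i ∈ C5 := by
    obtain ⟨b, hb5, hb1⟩ := hC5a
    obtain ⟨i, hi, rfl⟩ := hT.exists_edge b hb1
    exact ⟨i, hi, hb5⟩
  obtain ⟨p, ⟨hpn, hp5⟩, hpmin⟩ : ∃ p, (p < n ∧ e p ∈ C5) ∧ ∀ i < p, e i ∉ C5 :=
    ⟨Nat.find hex, Nat.find_spec hex, fun i hi h =>
      Nat.find_min hex hi ⟨hi.trans (Nat.find_spec hex).1, h⟩⟩
  have hp2 : p % 2 = 0 := by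
    have := (halt p hpn).not.1 (hC5sub hp5).2
    omega
  have hQ : ∀ i < p, e i ∈ Q := by
    have := hQmax (Q ∪ {b | ∃ i < p, b = e i}) ?_ ?_ ?_ Set.subset_union_left
    · intro i hi
      rw [← this]
      exact Or.inr ⟨i, hi, rfl⟩
    · rintro b (hb | ⟨i, -, rfl⟩)
      exacts [hQsub hb, hT.mem i]
    · refine Set.eq_empty_of_forall_notMem ?_
      rintro b ⟨hb | ⟨i, hi, rfl⟩, hb5⟩
      · have : b ∈ Q ∩ C5 := ⟨hb, hb5⟩
        simp [hQC5] at this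
      · exact hpmin i hi hb5
    · have hreach : ∀ i ≤ p, G.Reach (Q ∪ {b | ∃ i < p, b = e i}) u1 (f i) := by
        intro i
        induction i with
        | zero =>
          intro _
          rw [hf0]
          exact Relation.ReflTransGen.refl
        | succ i ih =>
          intro hi
          exact (ih (by omega)).tail ⟨e i, Or.inr ⟨i, hi, rfl⟩, hT.inc_eq i⟩
      rintro w ⟨b, hb | ⟨i, hi, rfl⟩, hwb⟩
      · exact (hQconn w ⟨b, hb, hwb⟩).mono Set.subset_union_left
      · rcases hT.mem_inc.1 hwb with rfl | rfl
        exacts [hreach i hi.le, hreach (i + 1) hi]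
  -- Traverse `C5` from there; the even edges are exactly those in `C1 ∪ C2`.
  obtain ⟨g, h, n5, hT5, hg0, hh0⟩ :=
    hC5.exists_traverses hp5 (hT.mem_inc.2 (Or.inl rfl) : f p ∈ G.inc (e p))
  have hg1 : g 1 = f (p + 1) := by
    have h1 := hT5.inc_eq 0
    rw [hh0, hg0, hT.inc_eq p] at h1
    exact (Sym2.congr_right.1 h1).symm
  have hswitch : ∀ (C : Set E), G.IsCircuit C → C ⊆ C1 ∪ C2 →
      (∀ c ∈ C1 ∪ C2, ∀ v ∈ G.inc c, v ∈ G.supp C → c ∈ C) →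
      ∀ i, g (i + 1) ∈ G.supp C → (h (i + 1) ∈ C1 ∪ C2 ↔ h i ∉ C1 ∪ C2) := by
    intro C hC hCsub hCin i hgi
    have hdeg := hC.2.1 _ hgi
    have hi1 : g (i + 1) ∈ G.inc (h i) := hT5.mem_inc.2 (Or.inr rfl)
    have hi2 : g (i + 1) ∈ G.inc (h (i + 1)) := hT5.mem_inc.2 (Or.inl rfl)
    have hi5 := hT5.vertex_mem_supp (i + 1)
    obtain ⟨b, ⟨hb, hvb⟩, -⟩ := hM2.2.2 (g (i + 1)) trivial
    have hbne : b ≠ e12 := by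
      rintro rfl
      rw [hinc, Sym2.mem_iff] at hvb
      rcases hvb with h' | h'
      exacts [hu1C5 (h' ▸ hi5), hu2C5 (h' ▸ hi5)]
    have hbC := hCin b (hM2C b hb hbne) _ hvb hgi
    have hnM : ∀ k, h k ≠ b := fun k hk => (hC5sub (hT5.mem k)).2 (hk ▸ hb)
    obtain ⟨c, hc, hvc, hcb⟩ := exists_ne_of_deg_eq_two hdeg b
    have hcM : c ∉ M2 := fun hcM => hcb (huniq _ _ _ hcM hb hvc hvb)
    have hc5 := mem_circuit_of_notMem_perfectMatching hcubic hM2 hC5 hC5sub hi5 hcM hvc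
    have hci := eq_or_eq_of_deg_eq_two (hC5.2.1 _ hi5) (hT5.mem i) hi1 (hT5.mem (i + 1)) hi2
      (hT5.ne_succ i) hc5 hvc
    constructor
    · intro h2 h1
      rcases eq_or_eq_of_deg_eq_two hdeg hbC hvb (hCin _ h1 _ hi1 hgi) hi1 (hnM i).symm
        (hCin _ h2 _ hi2 hgi) hi2 with h3 | h3
      exacts [hnM _ h3, hT5.ne_succ i h3.symm]
    · intro h1
      rcases hci with rfl | rfl
      exacts [absurd (hCsub hc) h1, hCsub hc]
  have hin1 : ∀ c ∈ C1 ∪ C2, ∀ v ∈ G.inc c, v ∈ G.supp C1 → c ∈ C1 := fun c hc v hv hv1 =>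
    hc.resolve_right fun hc2 => hdis v hv1 ⟨c, hc2, hv⟩
  have hin2 : ∀ c ∈ C1 ∪ C2, ∀ v ∈ G.inc c, v ∈ G.supp C2 → c ∈ C2 := fun c hc v hv hv2 =>
    hc.resolve_left fun hc1 => hdis v ⟨c, hc1, hv⟩ hv2
  have halt5 : ∀ i, (h i ∈ C1 ∪ C2 ↔ i % 2 = 0) := by
    intro i
    induction i with
    | zero => simp [hh0, hT.mem p]
    | succ i ih =>
      have : h (i + 1) ∈ C1 ∪ C2 ↔ h i ∉ C1 ∪ C2 := by
        by_cases hv : g (i + 1) ∈ G.supp C1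
        · exact hswitch C1 hC1 Set.subset_union_left hin1 i hv
        · exact hswitch C2 hC2 Set.subset_union_right hin2 i (hcov _ hv)
      rw [this, ih]
      omega
  -- The first vertex of `C2` met along `C5`.
  have hex5 : ∃ i, i < n5 ∧ g i ∉ G.supp C1 := by
    obtain ⟨b, hb5, hb2⟩ := hC5b
    obtain ⟨i, hi, rfl⟩ := hT5.exists_edge b hb5
    exact ⟨i, hi, fun h1 => hdis _ h1 ⟨_, hb2, hT5.mem_inc.2 (Or.inl rfl)⟩⟩
  obtain ⟨j, ⟨hjn, hgj⟩, hjmin⟩ :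
      ∃ j, (j < n5 ∧ g j ∉ G.supp C1) ∧ ∀ i < j, g i ∈ G.supp C1 :=
    ⟨Nat.find hex5, Nat.find_spec hex5, fun i hi => by
      by_contra hcon
      exact Nat.find_min hex5 hi ⟨hi.trans (Nat.find_spec hex5).1, hcon⟩⟩
  have hj0 : 0 < j := by
    rcases Nat.eq_zero_or_pos j with rfl | hj
    · exact absurd (hg0 ▸ hT.vertex_mem_supp p) hgj
    · exact hj
  have hj2 : j % 2 = 0 := by
    obtain ⟨l, rfl⟩ := Nat.exists_eq_add_of_lt hj0
    rw [zero_add] at *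
    by_contra hcon
    have hl := (halt5 l).2 (by omega)
    have hl1 := hin1 _ hl (g l) (hT5.mem_inc.2 (Or.inl rfl)) (hjmin l (by omega))
    exact hgj ⟨h l, hl1, hT5.mem_inc.2 (Or.inr rfl)⟩
  obtain ⟨N', hN'sub, hN'z, hN'⟩ := hC2.exists_near_perfect hodd2 (hcov _ hgj)
  refine ⟨_, hT5.isPM_exchange (S := G.supp C1) (N := shiftedMatching e n p) (N' := N') (j := j)
    (fun b hb v hv => ⟨b, hT.shiftedMatching_subset hb, hv⟩)
    (fun b hb => hg1 ▸ hT.notMem_inc_of_mem_shiftedMatching hp2 hpn hb)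
    (fun v hv hv1 => hT.existsUnique_mem_shiftedMatching hn hp2 hpn hv (hg1 ▸ hv1))
    (fun b hb v hv hv1 => hdis v hv1 ⟨b, hN'sub hb, hv⟩) hN'z
    (fun v hv hvj => hN' v (hcov v hv) hvj) hj0 hj2 hjn hjmin hgj ?_, ?_⟩
  · intro i hi hij hi2
    have hi1 := hin1 _ ((halt5 i).2 hi2) (g i) (hT5.mem_inc.2 (Or.inl rfl)) (hjmin i hij)
    obtain ⟨l, hl, hil⟩ := hT.exists_edge _ hi1
    have hl5 : e l ∈ C5 := hil ▸ hT5.mem i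
    have hl2 := (halt l hl).not.1 (hC5sub hl5).2
    have hlp : ¬ l < p := fun hlt => hpmin l hlt hl5
    have hne_p : l ≠ p := by
      rintro rfl
      have := hT5.edge_inj i 0 (by omega) (by omega) (hil.trans hh0.symm)
      omega
    exact ⟨l, by omega, hil⟩
  · rintro c ⟨⟨⟨-, hcM⟩, hc1⟩, hcQ⟩
    obtain ⟨i, hi, rfl⟩ := hT.exists_edge c hc1
    have hi2 := (halt i hi).not.1 hcM
    have hip : ¬ i < p := fun hlt => hcQ (Or.inl (hQ i hlt))
    have hne_p : i ≠ p := by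
      rintro rfl
      exact hcQ (Or.inr hp5)
    refine Or.inl (Or.inl ⟨⟨i, by omega, rfl⟩, ?_⟩)
    rintro ⟨l, -, -, hl⟩
    exact hcQ (Or.inr (hl ▸ hT5.mem l))
end
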